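/- arXiv:2407.11545 — 4 statements merged into one kernel-verified Lean document; each statement's English description precedes it below -/
import Mathlib

section
/- For any seeded Tile Automata system Y that non-committally simulates X_n under an m-block representation function R, and for any valid assembly sequence ⟨A_{π1}, ..., A_{πm}⟩ of Y such that R*(A_{πi}) = s (the single seed tile of X_n) for all 1 ≤ i ≤ m, at least one of the following holds: (1) for every 1 ≤ i ≤ n there exists an assembly A_i with A_{πm} →^Y_1 A_i and R*(A_i) = s·a_i, or (2) there exists an assembly A_{π(m+1)} with A_{πm} →^Y_1 A_{π(m+1)} and R*(A_{π(m+1)}) = s. -/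
open scoped Classical

/-- Positions in the plane. -/
abbrev Pos : Type := ℤ × ℤ

/-- An assembly: a finite partial placement of states (encoded as naturals) on `ℤ²`. -/
structure Assembly where
  tiles : Pos → Option ℕ
  finite : {p : Pos | tiles p ≠ none}.Finite

/-- A transition rule `((σ1, σ2), (σ3, σ4), d)`; `d = true` is horizontal
(first state west), `d = false` is vertical (first state north). -/
abbrev Rule : Type := (ℕ × ℕ) × (ℕ × ℕ) × Bool

/-- The neighbour of `p` in orientation `d` (east for horizontal, south for vertical). -/
def nbr (p : Pos) (d : Bool) : Pos := if d then (p.1 + 1, p.2) else (p.1, p.2 - 1)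

/-- The bond strength contributed by the ordered pair of positions `p`, `q` in `A`. -/
def bond (aff : ℕ → ℕ → Bool → ℕ) (A : Assembly) (p q : Pos) : ℕ :=
  match A.tiles p, A.tiles q with
  | some σ1, some σ2 =>
      (if q = nbr p true then aff σ1 σ2 true else 0) +
      (if q = nbr p false then aff σ1 σ2 false else 0)
  | _, _ => 0

/-- The total weight of the cut `S` in the bond graph of `A`. -/
noncomputable def cutWeight (aff : ℕ → ℕ → Bool → ℕ) (A : Assembly) (S : Set Pos) : ℕ :=
  ∑ p ∈ A.finite.toFinset, ∑ q ∈ A.finite.toFinset,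
    if p ∈ S ∧ q ∉ S then bond aff A p q + bond aff A q p else 0

/-- `A` is `τ`-stable: every cut separating the tiles of `A` has weight at least `τ`. -/
def StableAt (aff : ℕ → ℕ → Bool → ℕ) (τ : ℕ) (A : Assembly) : Prop :=
  ∀ S : Set Pos,
    (∃ p, A.tiles p ≠ none ∧ p ∈ S) → (∃ p, A.tiles p ≠ none ∧ p ∉ S) →
    τ ≤ cutWeight aff A S

/-- A transition rule is affinity strengthening: it maintains or increases the
affinity of the transitioning pair and of every other potential neighbour. -/
def Strengthening (aff : ℕ → ℕ → Bool → ℕ) (r : Rule) : Prop :=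
  aff r.1.1 r.1.2 r.2.2 ≤ aff r.2.1.1 r.2.1.2 r.2.2 ∧
  ∀ (σ : ℕ) (d : Bool),
    aff r.1.1 σ d ≤ aff r.2.1.1 σ d ∧ aff σ r.1.1 d ≤ aff σ r.2.1.1 d ∧
    aff r.1.2 σ d ≤ aff r.2.1.2 σ d ∧ aff σ r.1.2 d ≤ aff σ r.2.1.2 d

/-- A seeded Tile Automata system `(Σ, Λ, Π, Δ, s, τ)`. -/
structure TASystem where
  states : Finset ℕ
  initial : Finset ℕ
  aff : ℕ → ℕ → Bool → ℕ
  rules : Finset Rule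
  seed : Assembly
  temp : ℕ
  temp_pos : 0 < temp
  initial_sub : initial ⊆ states
  seed_states : ∀ p σ, seed.tiles p = some σ → σ ∈ states
  seed_stable : StableAt aff temp seed
  rules_strengthening : ∀ r ∈ rules, Strengthening aff r
  rules_states : ∀ r ∈ rules,
    r.1.1 ∈ states ∧ r.1.2 ∈ states ∧ r.2.1.1 ∈ states ∧ r.2.1.2 ∈ states

/-- A single-tile attachment step. -/
def AttachStep (Γ : TASystem) (A B : Assembly) : Prop :=
  ∃ (p : Pos) (σ : ℕ), σ ∈ Γ.initial ∧ A.tiles p = none ∧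
    B.tiles = Function.update A.tiles p (some σ) ∧
    StableAt Γ.aff Γ.temp B

/-- A pairwise transition step. -/
def TransStep (Γ : TASystem) (A B : Assembly) : Prop :=
  ∃ r ∈ Γ.rules, ∃ p : Pos,
    A.tiles p = some r.1.1 ∧ A.tiles (nbr p r.2.2) = some r.1.2 ∧
    B.tiles = Function.update (Function.update A.tiles p (some r.2.1.1))
      (nbr p r.2.2) (some r.2.1.2)

/-- A single production step `A →^Γ_1 B`. -/
def Step (Γ : TASystem) (A B : Assembly) : Prop := AttachStep Γ A B ∨ TransStep Γ A B

/-- `A →^Γ B`: reflexive-transitive closure of single steps. -/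
def Reach (Γ : TASystem) : Assembly → Assembly → Prop := Relation.ReflTransGen (Step Γ)

/-- The producible assemblies of `Γ`. -/
def Producible (Γ : TASystem) (A : Assembly) : Prop := Reach Γ Γ.seed A

/-- `m`-blocks over (ℕ-encoded) states. -/
abbrev Block (m : ℕ) : Type := Fin m × Fin m → Option ℕ

def emptyBlock (m : ℕ) : Block m := fun _ => none

/-- A valid `m`-block representation function maps the empty block to empty. -/
def RepFun (m : ℕ) (R : Block m → Option ℕ) : Prop :=
  0 < m ∧ R (emptyBlock m) = none

/-- The `m`-block of `A` with block coordinates `(x, y)`. -/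
def blockAt (m : ℕ) (A : Assembly) (x y : ℤ) : Block m :=
  fun ij => A.tiles ((m : ℤ) * x + (ij.1.1 : ℤ), (m : ℤ) * y + (ij.2.1 : ℤ))

/-- `B = R*(A)`: the blockwise image of `A` under `R`. -/
def RepMap (m : ℕ) (R : Block m → Option ℕ) (A B : Assembly) : Prop :=
  ∀ x y : ℤ, B.tiles (x, y) = R (blockAt m A x y)

/-- Condition 1 of equivalent productions: `{R*(A') : A' ∈ PROD_{Γ_S}} = PROD_{Γ_T}`. -/
def EquivProdSet (m : ℕ) (R : Block m → Option ℕ) (ΓS ΓT : TASystem) : Prop :=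
  (∀ A', Producible ΓS A' → ∃ A, Producible ΓT A ∧ RepMap m R A' A) ∧
  (∀ A, Producible ΓT A → ∃ A', Producible ΓS A' ∧ RepMap m R A' A)

/-- `Γ_S` achieves `c`-fuzz under `R*`. -/
def AchievesFuzz (m : ℕ) (R : Block m → Option ℕ) (ΓS : TASystem) (c : ℕ) : Prop :=
  ∀ A', Producible ΓS A' → ∀ x y : ℤ,
    blockAt m A' x y ≠ emptyBlock m → R (blockAt m A' x y) = none →
    ∃ u v : ℤ, |u| ≤ (c : ℤ) ∧ |v| ≤ (c : ℤ) ∧ R (blockAt m A' (x + u) (y + v)) ≠ none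

/-- `Γ_T` follows `Γ_S` under `R`. -/
def Follows (m : ℕ) (R : Block m → Option ℕ) (ΓS ΓT : TASystem) : Prop :=
  ∀ A' B', Producible ΓS A' → Reach ΓS A' B' →
    ∀ A B, RepMap m R A' A → RepMap m R B' B → Reach ΓT A B

/-- `Γ_S` non-committally models `Γ_T` under `R`. -/
def Models (m : ℕ) (R : Block m → Option ℕ) (ΓS ΓT : TASystem) : Prop :=
  ∀ A B, Producible ΓT A → Reach ΓT A B →
    ∀ A', Producible ΓS A' → RepMap m R A' A →
      ∃ B', Reach ΓS A' B' ∧ RepMap m R B' B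

/-- `Γ_S` non-committally simulates `Γ_T` under `R` with fuzz bound `c`. -/
def SimulatesFuzz (m : ℕ) (R : Block m → Option ℕ) (ΓS ΓT : TASystem) (c : ℕ) : Prop :=
  RepFun m R ∧ EquivProdSet m R ΓS ΓT ∧ AchievesFuzz m R ΓS c ∧
  Follows m R ΓS ΓT ∧ Models m R ΓS ΓT

/-- `Γ_S` non-committally simulates `Γ_T` under `R` (with some fuzz bound). -/
def Simulates (m : ℕ) (R : Block m → Option ℕ) (ΓS ΓT : TASystem) : Prop :=
  ∃ c : ℕ, 0 < c ∧ SimulatesFuzz m R ΓS ΓT c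
/-- The assembly consisting of a single tile in state `σ` at `p₀`. -/
def onePoint (p₀ : Pos) (σ : ℕ) : Assembly where
  tiles := fun p => if p = p₀ then some σ else none
  finite := Set.Finite.subset (Set.finite_singleton p₀) (by
    intro p hp
    simp only [Set.mem_setOf_eq] at hp
    by_contra h
    simp only [Set.mem_singleton_iff] at h
    rw [if_neg h] at hp
    exact hp rfl)

/-- The seed assembly of `X_n`: a single tile in state `S` (encoded as `0`) at the origin. -/
def seedX : Assembly := onePoint ((0 : ℤ), (0 : ℤ)) 0

/-- The assembly `s · a_i`: the seed tile with a tile in state `a_i` (encoded as `i`)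
attached to its east. -/
def seedDot (i : ℕ) : Assembly where
  tiles := fun p =>
    if p = ((0 : ℤ), (0 : ℤ)) then some 0
    else if p = ((1 : ℤ), (0 : ℤ)) then some i else none
  finite := Set.Finite.subset
      ((Set.finite_singleton ((0 : ℤ), (0 : ℤ))).insert ((1 : ℤ), (0 : ℤ))) (by
    intro p hp
    simp only [Set.mem_setOf_eq] at hp
    by_contra h
    simp only [Set.mem_insert_iff, Set.mem_singleton_iff] at h
    push_neg at h
    rw [if_neg h.2, if_neg h.1] at hp
    exact hp rfl)

/-- The passive system `X_n`: states `S = 0` and `a_1, …, a_n`, seed a single `S` tile,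
east–west affinity of strength `τ = 1` between `S` and each `a_i`, no transition rules. -/
noncomputable def X (n : ℕ) : TASystem where
  states := Finset.range (n + 1)
  initial := Finset.Icc 1 n
  aff := fun x y d =>
    if d = true ∧ ((x = 0 ∧ 1 ≤ y ∧ y ≤ n) ∨ (y = 0 ∧ 1 ≤ x ∧ x ≤ n)) then 1 else 0
  rules := ∅
  seed := seedX
  temp := 1
  temp_pos := Nat.one_pos
  initial_sub := by
    intro x hx
    simp only [Finset.mem_Icc] at hx
    simp only [Finset.mem_range]
    omega
  seed_states := by
    intro p σ h
    simp only [seedX, onePoint] at h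
    by_cases hp : p = ((0 : ℤ), (0 : ℤ))
    · rw [if_pos hp] at h
      simp only [Option.some.injEq] at h
      simp only [Finset.mem_range]
      omega
    · rw [if_neg hp] at h
      exact absurd h (by simp)
  seed_stable := by
    rintro S ⟨p, hp, hpS⟩ ⟨q, hq, hqS⟩
    exfalso
    have hp' : p = ((0 : ℤ), (0 : ℤ)) := by
      by_contra h
      apply hp
      simp only [seedX, onePoint]
      rw [if_neg h]
    have hq' : q = ((0 : ℤ), (0 : ℤ)) := by
      by_contra h
      apply hq
      simp only [seedX, onePoint]
      rw [if_neg h]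
    rw [hp'] at hpS
    rw [hq'] at hqS
    exact hqS hpS
  rules_strengthening := by intro r hr; simp at hr
  rules_states := by intro r hr; simp at hr

/-- `Γ` is a `k`-burnout system: in any production sequence from the seed,
each tile changes its state at most `k` times. -/
def Burnout (Γ : TASystem) (k : ℕ) : Prop :=
  ∀ (N : ℕ) (seq : Fin (N + 1) → Assembly), seq 0 = Γ.seed →
    (∀ i : Fin N, Step Γ (seq i.castSucc) (seq i.succ)) →
    ∀ p : Pos,
      (Finset.univ.filter (fun i : Fin N =>
        (seq i.castSucc).tiles p ≠ none ∧
        (seq i.succ).tiles p ≠ (seq i.castSucc).tiles p)).card ≤ k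

/-- A bounded system: `k`-burnout for some `k`. -/
def Bounded (Γ : TASystem) : Prop := ∃ k : ℕ, Burnout Γ k

/-- A passive system: `0`-burnout. -/
def Passive (Γ : TASystem) : Prop := Burnout Γ 0

theorem X_step_mono {n : ℕ} {A B : Assembly} (h : Step (X n) A B) {p : Pos} {σ : ℕ}
    (hp : A.tiles p = some σ) : B.tiles p = some σ := by
  rcases h with ⟨q, t, _, hq, hB, _⟩ | ⟨r, hr, _⟩
  · rw [hB]
    have : p ≠ q := by
      rintro rfl
      rw [hq] at hp
      cases hp
    rw [Function.update_of_ne this, hp]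
  · simp [X] at hr

theorem X_reach_mono {n : ℕ} {A B : Assembly} (h : Reach (X n) A B) {p : Pos} {σ : ℕ}
    (hp : A.tiles p = some σ) : B.tiles p = some σ := by
  unfold Reach at h
  induction h with
  | refl => exact hp
  | tail _ h ih => exact X_step_mono h ih

theorem seedDot_cut {n i : ℕ} (h1 : 1 ≤ i) (hn : i ≤ n) (S : Set Pos) (p q : Pos)
    (hp : (seedDot i).tiles p ≠ none) (hq : (seedDot i).tiles q ≠ none)
    (hpS : p ∈ S) (hqS : q ∉ S)
    (hb : 1 ≤ bond (X n).aff (seedDot i) p q + bond (X n).aff (seedDot i) q p) :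
    1 ≤ cutWeight (X n).aff (seedDot i) S := by
  unfold cutWeight
  have hp' : p ∈ (seedDot i).finite.toFinset := by simpa using hp
  have hq' : q ∈ (seedDot i).finite.toFinset := by simpa using hq
  refine le_trans ?_ (Finset.single_le_sum (fun _ _ => Nat.zero_le _) hp')
  refine le_trans ?_ (Finset.single_le_sum (fun _ _ => Nat.zero_le _) hq')
  rw [if_pos ⟨hpS, hqS⟩]
  exact hb

theorem seedDot_supp {i : ℕ} {p : Pos} (hp : (seedDot i).tiles p ≠ none) :
    p = (0, 0) ∨ p = (1, 0) := by
  by_contra h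
  push Not at h
  apply hp
  simp only [seedDot]
  rw [if_neg h.1, if_neg h.2]

theorem seedDot_bond {n i : ℕ} (h1 : 1 ≤ i) (hn : i ≤ n) :
    1 ≤ bond (X n).aff (seedDot i) (0, 0) (1, 0) := by
  simp [bond, seedDot, nbr, X, h1, hn]

theorem seedDot_stable {n i : ℕ} (h1 : 1 ≤ i) (hn : i ≤ n) :
    StableAt (X n).aff (X n).temp (seedDot i) := by
  have hb := seedDot_bond h1 hn
  rintro S ⟨p, hp, hpS⟩ ⟨q, hq, hqS⟩
  refine seedDot_cut h1 hn S p q hp hq hpS hqS ?_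
  rcases seedDot_supp hp with rfl | rfl <;> rcases seedDot_supp hq with rfl | rfl
  · exact absurd hpS hqS
  · omega
  · omega
  · exact absurd hpS hqS

theorem seedDot_step {n i : ℕ} (h1 : 1 ≤ i) (hn : i ≤ n) :
    Step (X n) seedX (seedDot i) := by
  refine Or.inl ⟨(1, 0), i, ?_, ?_, ?_, seedDot_stable h1 hn⟩
  · simp [X, h1, hn]
  · simp [seedX, onePoint]
  · funext p
    by_cases h : p = (1, 0)
    · subst h
      simp [seedDot]
    · rw [Function.update_of_ne h]
      simp [seedDot, seedX, onePoint, h]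

/-- Lemma: extensibility. For any system `Y` that non-committally
simulates `X_n` under `R`, and any valid assembly sequence of `Y` all of whose members
map to the seed tile `s` of `X_n`, either every attachment `s · a_i` can be modelled by
a single step from the last assembly, or the sequence can be extended by one more step
staying mapped to `s`. -/
theorem extensibility
    (n : ℕ) (Y : TASystem) (m : ℕ) (R : Block m → Option ℕ)
    (hsim : Simulates m R Y (X n))
    (k : ℕ) (seq : Fin (k + 1) → Assembly)
    (hprod : Producible Y (seq 0))
    (hsteps : ∀ i : Fin k, Step Y (seq i.castSucc) (seq i.succ))
    (hmaps : ∀ i : Fin (k + 1), RepMap m R (seq i) seedX) :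
    (∀ i : ℕ, 1 ≤ i → i ≤ n →
      ∃ Ai : Assembly, Step Y (seq (Fin.last k)) Ai ∧ RepMap m R Ai (seedDot i)) ∨
    (∃ A' : Assembly, Step Y (seq (Fin.last k)) A' ∧ RepMap m R A' seedX) := by
  obtain ⟨c, hc, hR, hE, hF, hfol, hmod⟩ := hsim
  have hall : ∀ j : Fin (k + 1), Producible Y (seq j) := by
    intro j
    induction j using Fin.induction with
    | zero => exact hprod
    | succ j ih => exact Relation.ReflTransGen.tail ih (hsteps j)
  have hlast := hall (Fin.last k)
  have hmap := hmaps (Fin.last k)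
  by_cases h2 : ∃ A' : Assembly, Step Y (seq (Fin.last k)) A' ∧ RepMap m R A' seedX
  · exact Or.inr h2
  left
  intro i h1 hn
  obtain ⟨B, hB, hBm⟩ := hmod seedX (seedDot i) Relation.ReflTransGen.refl
    (Relation.ReflTransGen.single (seedDot_step h1 hn)) _ hlast hmap
  rcases Relation.ReflTransGen.cases_head hB with heq | ⟨C, hC, hCB⟩
  · exfalso
    have e1 := hmap 1 0
    have e2 := hBm 1 0
    rw [← heq, ← e1] at e2
    simp [seedDot, seedX, onePoint] at e2
  · have hCp : Producible Y C := Relation.ReflTransGen.tail hlast hC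
    obtain ⟨D, hD, hDm⟩ := hE.1 C hCp
    have r1 : Reach (X n) seedX D := hD
    have r2 : Reach (X n) D (seedDot i) := hfol C B hCp hCB D _ hDm hBm
    have d0 : D.tiles (0, 0) = some 0 :=
      X_reach_mono r1 (by simp [seedX, onePoint])
    have dother : ∀ p, p ≠ (0, 0) → p ≠ (1, 0) → D.tiles p = none := by
      intro p hp0 hp1
      by_contra hne
      obtain ⟨σ, hσ⟩ := Option.ne_none_iff_exists'.mp hne
      have := X_reach_mono r2 hσ
      simp [seedDot, hp0, hp1] at this
    rcases hd1 : D.tiles (1, 0) with _ | σ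
    · exfalso
      apply h2
      refine ⟨C, hC, fun x y => ?_⟩
      rw [← hDm x y]
      by_cases h0 : ((x, y) : Pos) = (0, 0)
      · rw [h0, d0]; simp [seedX, onePoint]
      · by_cases h1' : ((x, y) : Pos) = (1, 0)
        · rw [h1', hd1]; simp [seedX, onePoint]
        · rw [dother _ h0 h1']; simp only [seedX, onePoint]; rw [if_neg h0]
    · refine ⟨C, hC, fun x y => ?_⟩
      rw [← hDm x y]
      by_cases h0 : ((x, y) : Pos) = (0, 0)
      · rw [h0, d0]; simp [seedDot]
      · by_cases h1' : ((x, y) : Pos) = (1, 0)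
        · rw [h1', hd1]; exact X_reach_mono r2 hd1
        · rw [dother _ h0 h1']; simp only [seedDot]; rw [if_neg h0, if_neg h1']
end

section
/- For any bounded seeded Tile Automata system Y that non-committally simulates X_n under an m-block representation function R, there exist assemblies A, A_1, ..., A_n ∈ PROD_Y such that R*(A) = s (the seed tile of X_n), and for all 1 ≤ i ≤ n, R*(A_i) = s·a_i and A →^Y_1 A_i (a single attachment or transition step). -/
open scoped Classical

namespace ELA

theorem ext' {A B : Assembly} (h : ∀ p, A.tiles p = B.tiles p) : A = B := by
  cases A; cases B
  have := funext h
  simp only at this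
  subst this
  rfl

theorem step_ne_none {Γ : TASystem} {A B : Assembly} (h : Step Γ A B) (p : Pos)
    (hp : A.tiles p ≠ none) : B.tiles p ≠ none := by
  rcases h with ⟨q, σ, _, hq, hB, _⟩ | ⟨r, _, q, _, _, hB⟩
  · rw [hB, Function.update_apply]; split_ifs <;> simp [hp]
  · rw [hB, Function.update_apply, Function.update_apply]; split_ifs <;> simp [hp]

theorem reach_X_some {n : ℕ} {A B : Assembly} (h : Reach (X n) A B) (p : Pos) (σ : ℕ)
    (hp : A.tiles p = some σ) : B.tiles p = some σ := by
  unfold Reach at h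
  induction h with
  | refl => exact hp
  | tail _ hs ih =>
    rcases hs with ⟨q, σ', _, hq, hB, _⟩ | ⟨r, hr, _⟩
    · rw [hB, Function.update_apply]
      split_ifs with h
      · rw [h, hq] at ih; cases ih
      · exact ih
    · simp [X] at hr

theorem stable_seedDot {n i : ℕ} (h1 : 1 ≤ i) (h2 : i ≤ n) :
    StableAt (X n).aff (X n).temp (seedDot i) := by
  have key : 1 ≤ bond (X n).aff (seedDot i) (0, 0) (1, 0) := by
    simp [bond, seedDot, nbr, X, h1, h2]
  have mem : ∀ p, (seedDot i).tiles p ≠ none → p = (0, 0) ∨ p = (1, 0) := by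
    intro p hp
    by_contra hc
    push Not at hc
    exact hp (by simp only [seedDot]; rw [if_neg hc.1, if_neg hc.2])
  have m0 : (0, 0) ∈ (seedDot i).finite.toFinset := by simp [seedDot]
  have m1 : (1, 0) ∈ (seedDot i).finite.toFinset := by simp [seedDot]
  have gen : ∀ (S : Set Pos) (p q : Pos), p ∈ (seedDot i).finite.toFinset →
      q ∈ (seedDot i).finite.toFinset → p ∈ S → q ∉ S →
      bond (X n).aff (seedDot i) p q + bond (X n).aff (seedDot i) q p ≤
        cutWeight (X n).aff (seedDot i) S := by
    intro S p q hp hq hpS hqS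
    unfold cutWeight
    refine le_trans ?_ (Finset.single_le_sum (fun _ _ => Nat.zero_le _) hp)
    refine le_trans ?_ (Finset.single_le_sum (fun _ _ => Nat.zero_le _) hq)
    rw [if_pos ⟨hpS, hqS⟩]
  rintro S ⟨p, hp, hpS⟩ ⟨q, hq, hqS⟩
  have ht : (X n).temp = 1 := rfl
  rw [ht]
  rcases mem p hp with rfl | rfl <;> rcases mem q hq with rfl | rfl
  · exact absurd hpS hqS
  · have := gen S _ _ m0 m1 hpS hqS; omega
  · have := gen S _ _ m1 m0 hpS hqS; omega
  · exact absurd hpS hqS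

theorem reach_seedDot {n i : ℕ} (h1 : 1 ≤ i) (h2 : i ≤ n) :
    Reach (X n) seedX (seedDot i) := by
  refine Relation.ReflTransGen.single (Or.inl ⟨(1, 0), i, ?_, ?_, ?_, stable_seedDot h1 h2⟩)
  · simp [X, h1, h2]
  · simp [seedX, onePoint]
  · funext p
    simp only [seedX, onePoint, seedDot, Function.update_apply]
    by_cases h : p = (0, 0)
    · subst h; simp
    · simp [h]

theorem between {n i : ℕ} {C : Assembly} (h1 : Reach (X n) seedX C)
    (h2 : Reach (X n) C (seedDot i)) : C = seedX ∨ C = seedDot i := by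
  have a0 : C.tiles (0, 0) = some 0 := reach_X_some h1 _ _ (by simp [seedX, onePoint])
  have hn : ∀ p, p ≠ (0, 0) → p ≠ (1, 0) → C.tiles p = none := by
    intro p hp hq
    by_contra hc
    obtain ⟨σ, hσ⟩ := Option.ne_none_iff_exists'.1 hc
    have := reach_X_some h2 _ _ hσ
    simp [seedDot, hp, hq] at this
  rcases hc : C.tiles (1, 0) with _ | σ
  · left
    apply ext'
    intro p
    by_cases hp : p = (0, 0)
    · subst hp; simp [a0, seedX, onePoint]
    · have : C.tiles p = none := by
        by_cases hq : p = (1, 0)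
        · rw [hq, hc]
        · exact hn p hp hq
      simp [this, seedX, onePoint, hp]
  · right
    have hs := reach_X_some h2 _ _ hc
    apply ext'
    intro p
    by_cases hp : p = (0, 0)
    · subst hp; simp [a0, seedDot]
    · by_cases hq : p = (1, 0)
      · rw [hq, hc, hs]
      · simp [hn p hp hq, seedDot, hp, hq]

theorem seedX_ne (i : ℕ) : seedX ≠ seedDot i := by
  intro h
  have := congrArg (fun A => A.tiles (1, 0)) h
  simp [seedX, onePoint, seedDot] at this

def NT (Γ : TASystem) (N : ℕ) (A : Assembly) : Prop :=
  ∃ f : ℕ → Assembly, f 0 = Γ.seed ∧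
    (∀ i < N, Step Γ (f i) (f (i + 1)) ∧ f i ≠ f (i + 1)) ∧ f N = A

theorem NT.succ {Γ : TASystem} {N : ℕ} {A B : Assembly} (h : NT Γ N A) (hs : Step Γ A B)
    (hne : A ≠ B) : NT Γ (N + 1) B := by
  obtain ⟨f, h0, hf, hN⟩ := h
  refine ⟨fun j => if j ≤ N then f j else B, by simp [h0], ?_, by simp⟩
  intro i hi
  rcases Nat.lt_succ_iff_lt_or_eq.1 hi with h | h
  · have h' : i + 1 ≤ N := h
    simp only [if_pos h.le, if_pos h']
    exact hf i h
  · subst h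
    simp [hN, hs, hne]

theorem exists_NT {Γ : TASystem} {A : Assembly} (h : Producible Γ A) : ∃ N, NT Γ N A := by
  unfold Producible Reach at h
  induction h with
  | refl => exact ⟨0, fun _ => Γ.seed, rfl, by simp, rfl⟩
  | @tail b c _ hs ih =>
    obtain ⟨N, hN⟩ := ih
    by_cases hbc : b = c
    · subst hbc; exact ⟨N, hN⟩
    · exact ⟨N + 1, hN.succ hs hbc⟩

theorem NT_bound {Γ : TASystem} {k N : ℕ} {A : Assembly} (hk : Burnout Γ k) (h : NT Γ N A)
    (P : Finset Pos) (hP : ∀ p, A.tiles p ≠ none → p ∈ P) : N ≤ P.card * (k + 1) := by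
  obtain ⟨f, h0, hf, hN⟩ := h
  have mono : ∀ i j, i ≤ j → j ≤ N → ∀ p, (f i).tiles p ≠ none → (f j).tiles p ≠ none := by
    intro i j hij
    induction j, hij using Nat.le_induction with
    | base => intro _ p hp; exact hp
    | succ j _ ih =>
      intro hj p hp
      exact step_ne_none (hf j hj).1 p (ih (by omega) p hp)
  have hnn : ∀ i < N, ∀ p, (f (i+1)).tiles p ≠ (f i).tiles p → (f (i+1)).tiles p ≠ none := by
    intro i hi p hp hc
    by_cases hq : (f i).tiles p = none
    · exact hp (hc.trans hq.symm)
    · exact step_ne_none (hf i hi).1 p hq hc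
  let T : Pos → Finset (Fin N) := fun p =>
    Finset.univ.filter (fun i : Fin N => (f (i.1+1)).tiles p ≠ (f i.1).tiles p)
  have hT : ∀ p ∈ P, (T p).card ≤ k + 1 := by
    intro p _
    let T1 : Finset (Fin N) := Finset.univ.filter (fun i : Fin N =>
      (f i.1).tiles p ≠ none ∧ (f (i.1+1)).tiles p ≠ (f i.1).tiles p)
    let T2 : Finset (Fin N) := Finset.univ.filter (fun i : Fin N =>
      (f i.1).tiles p = none ∧ (f (i.1+1)).tiles p ≠ (f i.1).tiles p)
    have c1 : T1.card ≤ k := by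
      have := hk N (fun i => f i.1) (by simpa using h0)
        (fun i => by simpa using (hf i.1 i.2).1) p
      simpa [T1] using this
    have c2 : T2.card ≤ 1 := by
      have aux : ∀ a b : Fin N, a ∈ T2 → b ∈ T2 → ¬ a.1 < b.1 := by
        intro a b ha hb hab
        simp only [T2, Finset.mem_filter, Finset.mem_univ, true_and] at ha hb
        exact mono (a.1+1) b.1 hab b.2.le p (hnn a.1 a.2 p ha.2) hb.1
      rw [Finset.card_le_one]
      intro a ha b hb
      have := aux a b ha hb
      have := aux b a hb ha
      apply Fin.ext
      omega
    have hsub : T p ⊆ T1 ∪ T2 := by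
      intro i hi
      simp only [T, T1, T2, Finset.mem_filter, Finset.mem_univ, true_and, Finset.mem_union] at hi ⊢
      tauto
    have := (Finset.card_le_card hsub).trans (Finset.card_union_le _ _)
    omega
  have hcov : (Finset.univ : Finset (Fin N)) ⊆ P.biUnion T := by
    intro i _
    have hne := (hf i.1 i.2).2
    have : ∃ p, (f (i.1+1)).tiles p ≠ (f i.1).tiles p := by
      by_contra hc
      push Not at hc
      exact hne (ext' fun p => (hc p).symm)
    obtain ⟨p, hp⟩ := this
    refine Finset.mem_biUnion.2 ⟨p, hP p ?_, by simpa [T] using hp⟩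
    rw [← hN]
    exact mono (i.1+1) N i.2 le_rfl p (hnn i.1 i.2 p hp)
  have := (Finset.card_le_card hcov).trans (Finset.card_biUnion_le_card_mul P T (k+1) hT)
  simpa using this

theorem reach_first {Γ : TASystem} {A B : Assembly} (h : Reach Γ A B) (hne : A ≠ B) :
    ∃ C, Step Γ A C ∧ A ≠ C ∧ Reach Γ C B := by
  unfold Reach at h
  induction h using Relation.ReflTransGen.head_induction_on with
  | refl => exact absurd rfl hne
  | @head a c hs hr ih =>
    by_cases hac : a = c
    · subst hac; exact ih hne
    · exact ⟨c, hs, hac, hr⟩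

theorem repMap_unique {m : ℕ} {R : Block m → Option ℕ} {A B C : Assembly}
    (h1 : RepMap m R A B) (h2 : RepMap m R A C) : B = C :=
  ext' fun p => (h1 p.1 p.2).trans (h2 p.1 p.2).symm

theorem exists_region {m c : ℕ} {R : Block m → Option ℕ} {Y : TASystem} (hm : 0 < m)
    (hf : AchievesFuzz m R Y c) (h0 : R (emptyBlock m) = none) :
    ∃ P : Finset Pos, ∀ A, Producible Y A → RepMap m R A seedX →
      ∀ p, A.tiles p ≠ none → p ∈ P := by
  let g : (ℤ × ℤ) × (Fin m × Fin m) → Pos := fun z =>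
    ((m : ℤ) * z.1.1 + (z.2.1.1 : ℤ), (m : ℤ) * z.1.2 + (z.2.2.1 : ℤ))
  refine ⟨((Finset.Icc (-(c:ℤ)) c ×ˢ Finset.Icc (-(c:ℤ)) c) ×ˢ Finset.univ).image g, ?_⟩
  intro A hA hR p hp
  have hm' : (0 : ℤ) < m := by exact_mod_cast hm
  have lift : ∀ x : ℤ, ∃ i : Fin m, (m : ℤ) * (x / m) + (i.1 : ℤ) = x := by
    intro x
    have a1 := Int.emod_nonneg x hm'.ne'
    have a2 := Int.emod_lt_of_pos x hm'
    refine ⟨⟨(x % m).toNat, by omega⟩, ?_⟩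
    simp only [Int.toNat_of_nonneg a1]
    exact Int.mul_ediv_add_emod x m
  obtain ⟨i, hi⟩ := lift p.1
  obtain ⟨j, hj⟩ := lift p.2
  have hb : blockAt m A (p.1 / m) (p.2 / m) ≠ emptyBlock m := by
    intro hc
    have := congrFun hc (i, j)
    simp only [blockAt, emptyBlock, hi, hj] at this
    exact hp this
  have only : ∀ x y : ℤ, R (blockAt m A x y) ≠ none → x = 0 ∧ y = 0 := by
    intro x y h
    rw [← hR x y] at h
    by_contra hc
    apply h
    simp only [seedX, onePoint]
    rw [if_neg]
    simpa using hc
  have hxy : |p.1 / m| ≤ (c : ℤ) ∧ |p.2 / m| ≤ (c : ℤ) := by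
    by_cases hr : R (blockAt m A (p.1 / m) (p.2 / m)) = none
    · obtain ⟨u, v, hu, hv, huv⟩ := hf A hA _ _ hb hr
      obtain ⟨e1, e2⟩ := only _ _ huv
      rw [abs_le] at *
      rw [abs_le] at *
      omega
    · obtain ⟨e1, e2⟩ := only _ _ hr
      rw [e1, e2]; simp
  rw [abs_le, abs_le] at hxy
  refine Finset.mem_image.2 ⟨((p.1 / m, p.2 / m), (i, j)), ?_, ?_⟩
  · simp [hxy]
  · simp only [g, hi, hj]

end ELA

/-- Lemma: equal last assembly. For any bounded system `Y` that
non-committally simulates `X_n` under `R`, there exist producible assemblies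
`A, A_1, …, A_n` of `Y` with `R*(A) = s`, and for each `1 ≤ i ≤ n`,
`R*(A_i) = s·a_i` and `A →^Y_1 A_i`. -/
theorem equalLastAssembly
    (n : ℕ) (Y : TASystem) (hB : Bounded Y) (m : ℕ) (R : Block m → Option ℕ)
    (hsim : Simulates m R Y (X n)) :
    ∃ A : Assembly, Producible Y A ∧ RepMap m R A seedX ∧
      ∀ i : ℕ, 1 ≤ i → i ≤ n →
        ∃ Ai : Assembly, Producible Y Ai ∧ RepMap m R Ai (seedDot i) ∧ Step Y A Ai := by
  classical
  obtain ⟨c, _, ⟨hm, h0⟩, ⟨he1, he2⟩, hfz, hfol, hmod⟩ := hsim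
  obtain ⟨k, hk⟩ := hB
  obtain ⟨P, hP⟩ := ELA.exists_region hm hfz h0
  let Q : ℕ → Prop := fun N => ∃ A, ELA.NT Y N A ∧ Producible Y A ∧ RepMap m R A seedX
  have hbd : ∀ N, Q N → N ≤ P.card * (k + 1) := by
    rintro N ⟨A, hN, hA, hR⟩
    exact ELA.NT_bound hk hN P (hP A hA hR)
  have hseed : Producible (X n) seedX := Relation.ReflTransGen.refl
  obtain ⟨A', hA', hR'⟩ := he2 seedX hseed
  obtain ⟨N', hN'⟩ := ELA.exists_NT hA'
  have hQ' : Q N' := ⟨A', hN', hA', hR'⟩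
  have hspec : Q (Nat.findGreatest Q (P.card * (k + 1))) :=
    Nat.findGreatest_spec (hbd N' hQ') hQ'
  obtain ⟨A, hN, hA, hR⟩ := hspec
  have hmax : ∀ C, Step Y A C → A ≠ C → ¬ RepMap m R C seedX := by
    intro C hs hne hC
    have hq : Q (Nat.findGreatest Q (P.card * (k + 1)) + 1) :=
      ⟨C, hN.succ hs hne, Relation.ReflTransGen.tail hA hs, hC⟩
    have := Nat.le_findGreatest (hbd _ hq) hq
    omega
  refine ⟨A, hA, hR, ?_⟩
  intro i h1 h2
  obtain ⟨B, hAB, hRB⟩ := hmod seedX (seedDot i) hseed (ELA.reach_seedDot h1 h2) A hA hR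
  have hne : A ≠ B := by
    rintro rfl
    exact ELA.seedX_ne i (ELA.repMap_unique hR hRB)
  obtain ⟨C, hs, hAC, hCB⟩ := ELA.reach_first hAB hne
  have hC : Producible Y C := Relation.ReflTransGen.tail hA hs
  obtain ⟨D, hD, hRD⟩ := he1 C hC
  have r1 := hfol A C hA (Relation.ReflTransGen.single hs) _ _ hR hRD
  have r2 := hfol C B hC hCB _ _ hRD hRB
  rcases ELA.between r1 r2 with rfl | rfl
  · exact absurd hRD (hmax C hs hAC)
  · exact ⟨C, hC, hRD, hs⟩
end

section
/- A bounded seeded Tile Automata system with fewer than n^{1/5} states cannot non-committally simulate the system X_n. -/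
open scoped Classical

theorem asm_ext {A B : Assembly} (h : A.tiles = B.tiles) : A = B := by
  cases A; cases B; simp only at h; subst h; rfl

/-- `σ'` has at least the affinities of `σ`. -/
def DomSt (aff : ℕ → ℕ → Bool → ℕ) (σ σ' : ℕ) : Prop :=
  ∀ (x : ℕ) (d : Bool), aff σ x d ≤ aff σ' x d ∧ aff x σ d ≤ aff x σ' d

def DomAsm (aff : ℕ → ℕ → Bool → ℕ) (A B : Assembly) : Prop :=
  ∀ p σ, A.tiles p = some σ → ∃ σ', B.tiles p = some σ' ∧ DomSt aff σ σ'

theorem domSt_refl (aff : ℕ → ℕ → Bool → ℕ) (σ : ℕ) : DomSt aff σ σ :=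
  fun _ _ => ⟨le_rfl, le_rfl⟩

theorem domAsm_refl (aff : ℕ → ℕ → Bool → ℕ) (A : Assembly) : DomAsm aff A A :=
  fun _ σ h => ⟨σ, h, domSt_refl aff σ⟩

theorem bond_mono {aff : ℕ → ℕ → Bool → ℕ} {A B : Assembly} (h : DomAsm aff A B) (p q : Pos) :
    bond aff A p q ≤ bond aff B p q := by
  unfold bond
  rcases hp : A.tiles p with _ | a
  · simp
  rcases hq : A.tiles q with _ | b
  · simp
  obtain ⟨a', ha', da⟩ := h p a hp
  obtain ⟨b', hb', db⟩ := h q b hq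
  rw [ha', hb']
  have key : ∀ d, aff a b d ≤ aff a' b' d := fun d => ((da b d).1).trans ((db a' d).2)
  simp only
  have h1 := key true
  have h2 := key false
  split_ifs <;> omega

theorem cut_mono {aff : ℕ → ℕ → Bool → ℕ} {A B : Assembly} (h : DomAsm aff A B) (S : Set Pos) :
    cutWeight aff A S ≤ cutWeight aff B S := by
  have hsub : A.finite.toFinset ⊆ B.finite.toFinset := by
    intro p hp
    simp only [Set.Finite.mem_toFinset, Set.mem_setOf_eq] at hp ⊢
    obtain ⟨a, ha⟩ := Option.ne_none_iff_exists'.1 hp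
    obtain ⟨a', ha', -⟩ := h p a ha
    simp [ha']
  unfold cutWeight
  refine (Finset.sum_le_sum (fun p _ => ?_)).trans
    (Finset.sum_le_sum_of_subset_of_nonneg hsub (fun _ _ _ => Nat.zero_le _))
  refine (Finset.sum_le_sum (fun q _ => ?_)).trans
    (Finset.sum_le_sum_of_subset_of_nonneg hsub (fun _ _ _ => Nat.zero_le _))
  have h1 := bond_mono h p q
  have h2 := bond_mono h q p
  split_ifs <;> omega

theorem stable_glue {aff : ℕ → ℕ → Bool → ℕ} {τ : ℕ} {B1 B2 C : Assembly}
    (h1 : StableAt aff τ B1) (h2 : StableAt aff τ B2)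
    (d1 : DomAsm aff B1 C) (d2 : DomAsm aff B2 C)
    (hs : ∀ p, C.tiles p ≠ none → B1.tiles p ≠ none ∨ B2.tiles p ≠ none)
    (a : Pos) (ha1 : B1.tiles a ≠ none) (ha2 : B2.tiles a ≠ none) : StableAt aff τ C := by
  rintro S ⟨x, hx, hxS⟩ ⟨y, hy, hyS⟩
  by_cases haS : a ∈ S
  · rcases hs y hy with h | h
    · exact (h1 S ⟨a, ha1, haS⟩ ⟨y, h, hyS⟩).trans (cut_mono d1 S)
    · exact (h2 S ⟨a, ha2, haS⟩ ⟨y, h, hyS⟩).trans (cut_mono d2 S)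
  · rcases hs x hx with h | h
    · exact (h1 S ⟨x, h, hxS⟩ ⟨a, ha1, haS⟩).trans (cut_mono d1 S)
    · exact (h2 S ⟨x, h, hxS⟩ ⟨a, ha2, haS⟩).trans (cut_mono d2 S)

theorem nbr_ne (p : Pos) (d : Bool) : nbr p d ≠ p := by
  obtain ⟨x, y⟩ := p
  cases d <;> simp [nbr]

def updAsm (A : Assembly) (p : Pos) (σ : ℕ) : Assembly where
  tiles := Function.update A.tiles p (some σ)
  finite := by
    refine (A.finite.insert p).subset ?_
    intro q hq
    by_cases h : q = p
    · exact Or.inl h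
    · right
      simpa [Function.update_of_ne h] using hq

def trAsm (A : Assembly) (p : Pos) (r : Rule) : Assembly :=
  updAsm (updAsm A p r.2.1.1) (nbr p r.2.2) r.2.1.2

theorem updAsm_self (A : Assembly) (p : Pos) (σ : ℕ) : (updAsm A p σ).tiles p = some σ := by
  simp [updAsm]

theorem updAsm_ne (A : Assembly) (p q : Pos) (σ : ℕ) (h : q ≠ p) :
    (updAsm A p σ).tiles q = A.tiles q := by
  simp [updAsm, Function.update_of_ne h]

theorem updAsm_comm (A : Assembly) (p q : Pos) (σ τ : ℕ) (h : p ≠ q) :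
    updAsm (updAsm A p σ) q τ = updAsm (updAsm A q τ) p σ := by
  apply asm_ext
  simp only [updAsm]
  rw [Function.update_comm h]

def AttAt (Γ : TASystem) (A : Assembly) (p : Pos) (σ : ℕ) : Prop :=
  σ ∈ Γ.initial ∧ A.tiles p = none ∧ StableAt Γ.aff Γ.temp (updAsm A p σ)

def TrAt (Γ : TASystem) (A : Assembly) (p : Pos) (r : Rule) : Prop :=
  r ∈ Γ.rules ∧ A.tiles p = some r.1.1 ∧ A.tiles (nbr p r.2.2) = some r.1.2

theorem step_iff (Γ : TASystem) (A B : Assembly) : Step Γ A B ↔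
    (∃ p σ, AttAt Γ A p σ ∧ B = updAsm A p σ) ∨ (∃ p r, TrAt Γ A p r ∧ B = trAsm A p r) := by
  unfold Step AttachStep TransStep
  apply or_congr
  · constructor
    · rintro ⟨p, σ, h1, h2, h3, h4⟩
      have : B = updAsm A p σ := asm_ext h3
      exact ⟨p, σ, ⟨h1, h2, this ▸ h4⟩, this⟩
    · rintro ⟨p, σ, ⟨h1, h2, h4⟩, rfl⟩
      exact ⟨p, σ, h1, h2, rfl, h4⟩
  · constructor
    · rintro ⟨r, hr, p, h1, h2, h3⟩
      exact ⟨p, r, ⟨hr, h1, h2⟩, asm_ext h3⟩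
    · rintro ⟨p, r, ⟨hr, h1, h2⟩, rfl⟩
      exact ⟨r, hr, p, h1, h2, rfl⟩

theorem dom_upd_none (aff : ℕ → ℕ → Bool → ℕ) (A : Assembly) (p : Pos) (σ : ℕ)
    (h : A.tiles p = none) : DomAsm aff A (updAsm A p σ) := by
  intro q s hq
  have : q ≠ p := by rintro rfl; simp [h] at hq
  exact ⟨s, by rw [updAsm_ne _ _ _ _ this, hq], domSt_refl _ _⟩

theorem trAsm_of_ne (A : Assembly) (p q : Pos) (r : Rule) (h1 : q ≠ p) (h2 : q ≠ nbr p r.2.2) :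
    (trAsm A p r).tiles q = A.tiles q := by
  rw [trAsm, updAsm_ne _ _ _ _ h2, updAsm_ne _ _ _ _ h1]

theorem dom_tr {Γ : TASystem} {A : Assembly} {p : Pos} {r : Rule} (h : TrAt Γ A p r) :
    DomAsm Γ.aff A (trAsm A p r) := by
  obtain ⟨hr, h1, h2⟩ := h
  have hs := (Γ.rules_strengthening r hr).2
  intro q s hq
  by_cases e2 : q = nbr p r.2.2
  · refine ⟨r.2.1.2, by rw [e2, trAsm, updAsm_self], ?_⟩
    rw [e2, h2] at hq
    cases hq
    exact fun x d => ⟨(hs x d).2.2.1, (hs x d).2.2.2⟩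
  · by_cases e1 : q = p
    · refine ⟨r.2.1.1, by rw [trAsm, updAsm_ne _ _ _ _ e2, e1, updAsm_self], ?_⟩
      rw [e1, h1] at hq
      cases hq
      exact fun x d => ⟨(hs x d).1, (hs x d).2.1⟩
    · exact ⟨s, by rw [trAsm_of_ne _ _ _ _ e1 e2, hq], domSt_refl _ _⟩

theorem tr_supp {Γ : TASystem} {A : Assembly} {p : Pos} {r : Rule} (h : TrAt Γ A p r) (q : Pos) :
    (trAsm A p r).tiles q = none ↔ A.tiles q = none := by
  by_cases e2 : q = nbr p r.2.2
  · rw [e2, trAsm, updAsm_self, h.2.2]; simp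
  · by_cases e1 : q = p
    · rw [trAsm, updAsm_ne _ _ _ _ e2, e1, updAsm_self, h.2.1]; simp
    · rw [trAsm_of_ne _ _ _ _ e1 e2]

theorem comm_att_att {Γ : TASystem} {A : Assembly} {p q : Pos} {σ τ : ℕ}
    (a : Pos) (ha : A.tiles a ≠ none) (h1 : AttAt Γ A p σ) (h2 : AttAt Γ A q τ) (hpq : p ≠ q) :
    ∃ C, Step Γ (updAsm A p σ) C ∧ Step Γ (updAsm A q τ) C := by
  have c := updAsm_comm A p q σ τ hpq
  have n1 : (updAsm A p σ).tiles q = none := by rw [updAsm_ne _ _ _ _ hpq.symm]; exact h2.2.1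
  have n2 : (updAsm A q τ).tiles p = none := by rw [updAsm_ne _ _ _ _ hpq]; exact h1.2.1
  have d1 := dom_upd_none Γ.aff _ q τ n1
  have d2 := dom_upd_none Γ.aff _ p σ n2
  have hap : a ≠ p := by rintro rfl; exact ha h1.2.1
  have haq : a ≠ q := by rintro rfl; exact ha h2.2.1
  have st : StableAt Γ.aff Γ.temp (updAsm (updAsm A p σ) q τ) := by
    refine stable_glue h1.2.2 h2.2.2 d1 (c ▸ d2) ?_ a
      (by rwa [updAsm_ne _ _ _ _ hap]) (by rwa [updAsm_ne _ _ _ _ haq])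
    intro x hx
    by_cases e : x = q
    · right; rw [e, updAsm_self]; simp
    · left; rwa [updAsm_ne _ _ _ _ e] at hx
  exact ⟨_, (step_iff _ _ _).2 (Or.inl ⟨q, τ, ⟨h2.1, n1, st⟩, rfl⟩),
    (step_iff _ _ _).2 (Or.inl ⟨p, σ, ⟨h1.1, n2, c ▸ st⟩, c⟩)⟩

theorem comm_att_tr {Γ : TASystem} {A : Assembly} {p q : Pos} {σ : ℕ} {r : Rule}
    (h1 : AttAt Γ A p σ) (h2 : TrAt Γ A q r) :
    ∃ C, Step Γ (updAsm A p σ) C ∧ Step Γ (trAsm A q r) C := by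
  have e1 : p ≠ q := by rintro rfl; have := h1.2.1; simp [h2.2.1] at this
  have e2 : p ≠ nbr q r.2.2 := by intro e; have := h1.2.1; rw [e, h2.2.2] at this; cases this
  have c : trAsm (updAsm A p σ) q r = updAsm (trAsm A q r) p σ := by
    rw [trAsm, trAsm, updAsm_comm _ p q _ _ e1, updAsm_comm _ p _ _ _ e2]
  have t : TrAt Γ (updAsm A p σ) q r :=
    ⟨h2.1, by rw [updAsm_ne _ _ _ _ e1.symm]; exact h2.2.1,
      by rw [updAsm_ne _ _ _ _ e2.symm]; exact h2.2.2⟩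
  have st : StableAt Γ.aff Γ.temp (trAsm (updAsm A p σ) q r) := by
    have hp : (updAsm A p σ).tiles p ≠ none := by rw [updAsm_self]; simp
    refine stable_glue h1.2.2 h1.2.2 (dom_tr t) (dom_tr t) ?_ p hp hp
    intro x hx
    left
    rwa [Ne, tr_supp t] at hx
  refine ⟨_, (step_iff _ _ _).2 (Or.inr ⟨q, r, t, rfl⟩),
    (step_iff _ _ _).2 (Or.inl ⟨p, σ, ⟨h1.1, ?_, c ▸ st⟩, c⟩)⟩
  rw [tr_supp h2]; exact h1.2.1

theorem comm_tr_tr {Γ : TASystem} {A : Assembly} {p q : Pos} {r s : Rule}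
    (h1 : TrAt Γ A p r) (h2 : TrAt Γ A q s)
    (e1 : p ≠ q) (e2 : p ≠ nbr q s.2.2) (e3 : nbr p r.2.2 ≠ q) (e4 : nbr p r.2.2 ≠ nbr q s.2.2) :
    ∃ C, Step Γ (trAsm A p r) C ∧ Step Γ (trAsm A q s) C := by
  have c : trAsm (trAsm A p r) q s = trAsm (trAsm A q s) p r := by
    simp only [trAsm]
    rw [updAsm_comm _ _ q _ _ e3, updAsm_comm _ p q _ _ e1, updAsm_comm _ _ _ _ _ e4,
      updAsm_comm _ p _ _ _ e2]
  refine ⟨_, (step_iff _ _ _).2 (Or.inr ⟨q, s, ⟨h2.1, ?_, ?_⟩, rfl⟩),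
    (step_iff _ _ _).2 (Or.inr ⟨p, r, ⟨h1.1, ?_, ?_⟩, c⟩)⟩
  · rw [trAsm_of_ne _ _ _ _ e1.symm e3.symm]; exact h2.2.1
  · rw [trAsm_of_ne _ _ _ _ e2.symm e4.symm]; exact h2.2.2
  · rw [trAsm_of_ne _ _ _ _ e1 e2]; exact h1.2.1
  · rw [trAsm_of_ne _ _ _ _ e3 e4]; exact h1.2.2

theorem step_supp {Γ : TASystem} {A B : Assembly} (h : Step Γ A B) (p : Pos)
    (hp : A.tiles p ≠ none) : B.tiles p ≠ none := by
  rcases (step_iff _ _ _).1 h with ⟨q, σ, h1, rfl⟩ | ⟨q, r, h1, rfl⟩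
  · have : p ≠ q := by rintro rfl; exact hp h1.2.1
    rwa [updAsm_ne _ _ _ _ this]
  · rwa [Ne, tr_supp h1]

theorem upd_states {Γ : TASystem} {A : Assembly} {p : Pos} {σ : ℕ} (hσ : σ ∈ Γ.states)
    (hA : ∀ q s, A.tiles q = some s → s ∈ Γ.states) :
    ∀ q s, (updAsm A p σ).tiles q = some s → s ∈ Γ.states := by
  intro q s h
  by_cases e : q = p
  · rw [e, updAsm_self] at h; cases h; exact hσ
  · rw [updAsm_ne _ _ _ _ e] at h; exact hA q s h

theorem prod_states {Γ : TASystem} {A : Assembly} (h : Producible Γ A) :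
    ∀ p σ, A.tiles p = some σ → σ ∈ Γ.states := by
  induction h with
  | refl => exact Γ.seed_states
  | tail _ hs ih =>
    rcases (step_iff _ _ _).1 hs with ⟨q, τ, h1, rfl⟩ | ⟨q, r, h1, rfl⟩
    · exact upd_states (Γ.initial_sub h1.1) ih
    · have := Γ.rules_states r h1.1
      exact upd_states this.2.2.2 (upd_states this.2.2.1 ih)

theorem X_mono {n : ℕ} {A B : Assembly} (h : Reach (X n) A B) (p : Pos) (σ : ℕ)
    (hp : A.tiles p = some σ) : B.tiles p = some σ := by
  induction h with
  | refl => exact hp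
  | tail _ hs ih =>
    rcases (step_iff _ _ _).1 hs with ⟨q, τ, h1, rfl⟩ | ⟨q, r, h1, rfl⟩
    · have : p ≠ q := by rintro rfl; have := h1.2.1; simp [ih] at this
      rw [updAsm_ne _ _ _ _ this]; exact ih
    · have := h1.1
      simp [X] at this

theorem X_step (n i : ℕ) (h1 : 1 ≤ i) (h2 : i ≤ n) : Step (X n) seedX (seedDot i) := by
  left
  refine ⟨((1 : ℤ), (0 : ℤ)), i, by simp [X, h1, h2], by simp [seedX, onePoint], ?_, ?_⟩
  · funext p
    by_cases e : p = ((1 : ℤ), (0 : ℤ))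
    · subst e; simp [seedDot]
    · rw [Function.update_of_ne e]
      simp [seedDot, seedX, onePoint, e]
  · have t0 : (seedDot i).tiles (0, 0) = some 0 := by simp [seedDot]
    have t1 : (seedDot i).tiles (1, 0) = some i := by simp [seedDot]
    have hm0 : ((0 : ℤ), (0 : ℤ)) ∈ (seedDot i).finite.toFinset := by simp [t0]
    have hm1 : ((1 : ℤ), (0 : ℤ)) ∈ (seedDot i).finite.toFinset := by simp [t1]
    have hb : bond (X n).aff (seedDot i) (0, 0) (1, 0) ≥ 1 := by
      unfold bond; rw [t0, t1]; simp [nbr, X, h1, h2]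
    have occ : ∀ p, (seedDot i).tiles p ≠ none → p = (0, 0) ∨ p = (1, 0) := by
      intro p hp
      by_contra hc
      push Not at hc
      apply hp
      simp only [seedDot]
      rw [if_neg hc.1, if_neg hc.2]
    have key : ∀ (S : Set Pos) (p q : Pos), p ∈ (seedDot i).finite.toFinset →
        q ∈ (seedDot i).finite.toFinset → p ∈ S → q ∉ S →
        bond (X n).aff (seedDot i) p q + bond (X n).aff (seedDot i) q p ≤
          cutWeight (X n).aff (seedDot i) S := by
      intro S p q hp hq hpS hqS
      unfold cutWeight
      refine le_trans ?_ (Finset.single_le_sum (fun _ _ => Nat.zero_le _) hp)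
      refine le_trans ?_ (Finset.single_le_sum (fun _ _ => Nat.zero_le _) hq)
      rw [if_pos ⟨hpS, hqS⟩]
    rintro S ⟨x, hx, hxS⟩ ⟨y, hy, hyS⟩
    show 1 ≤ _
    rcases occ x hx with rfl | rfl <;> rcases occ y hy with rfl | rfl
    · exact absurd hxS hyS
    · have := key S _ _ hm0 hm1 hxS hyS; omega
    · have := key S _ _ hm1 hm0 hxS hyS; omega
    · exact absurd hxS hyS

theorem first_change {Γ : TASystem} {A B : Assembly} (h : Reach Γ A B) (hne : A ≠ B) :
    ∃ C, Step Γ A C ∧ A ≠ C ∧ Reach Γ C B := by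
  induction h using Relation.ReflTransGen.head_induction_on with
  | refl => exact absurd rfl hne
  | head hs hr ih =>
    rename_i a c
    by_cases e : a = c
    · subst e; exact ih hne
    · exact ⟨c, hs, e, hr⟩

/-- A production sequence of `N` genuine steps. -/
def GenSeq (Γ : TASystem) (N : ℕ) (A : Assembly) : Prop :=
  ∃ f : ℕ → Assembly, f 0 = Γ.seed ∧ f N = A ∧
    ∀ i < N, Step Γ (f i) (f (i + 1)) ∧ f i ≠ f (i + 1)

theorem genSeq_succ {Γ : TASystem} {N : ℕ} {A B : Assembly} (h : GenSeq Γ N A)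
    (hs : Step Γ A B) (hne : A ≠ B) : GenSeq Γ (N + 1) B := by
  obtain ⟨f, h0, hN, hf⟩ := h
  refine ⟨fun j => if j ≤ N then f j else B, by simp [h0], by simp, ?_⟩
  intro i hi
  rcases Nat.lt_succ_iff_lt_or_eq.1 hi with h | h
  · have h' : i + 1 ≤ N := h
    have h'' : i ≤ N := h.le
    simp only [h', h'', if_true]
    exact hf i h
  · subst h
    simp only [le_refl, if_true, Nat.not_succ_le_self, if_false, hN]
    exact ⟨hs, hne⟩

theorem genSeq_exists {Γ : TASystem} {A : Assembly} (h : Producible Γ A) :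
    ∃ N, GenSeq Γ N A := by
  induction h with
  | refl => exact ⟨0, fun _ => Γ.seed, rfl, rfl, by simp⟩
  | tail _ hs ih =>
    rename_i b c _
    obtain ⟨N, hN⟩ := ih
    by_cases e : b = c
    · exact ⟨N, e ▸ hN⟩
    · exact ⟨N + 1, genSeq_succ hN hs e⟩

theorem genSeq_prod {Γ : TASystem} {N : ℕ} {A : Assembly} (h : GenSeq Γ N A) :
    Producible Γ A := by
  obtain ⟨f, h0, hN, hf⟩ := h
  have : ∀ j ≤ N, Reach Γ Γ.seed (f j) := by
    intro j
    induction j with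
    | zero => intro _; rw [h0]; exact Relation.ReflTransGen.refl
    | succ j ih => intro hj; exact (ih (by omega)).tail (hf j hj).1
  exact hN ▸ this N le_rfl

theorem genSeq_bound {Γ : TASystem} {k : ℕ} (hB : Burnout Γ k) (F : Finset Pos) {N : ℕ}
    {A : Assembly} (h : GenSeq Γ N A) (hF : ∀ p, A.tiles p ≠ none → p ∈ F) :
    N ≤ F.card * (k + 1) := by
  obtain ⟨f, h0, hN, hf⟩ := h
  have mono : ∀ (p : Pos) (i j : ℕ), i ≤ j → j ≤ N → (f i).tiles p ≠ none →
      (f j).tiles p ≠ none := by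
    intro p i j hij
    induction j, hij using Nat.le_induction with
    | base => intro _ h; exact h
    | succ j hj ih => intro hjN h; exact step_supp (hf j hjN).1 p (ih (by omega) h)
  let ch : Pos → Finset (Fin N) := fun p => Finset.univ.filter (fun i : Fin N =>
    (f (i.1 + 1)).tiles p ≠ (f i.1).tiles p)
  have hcard : ∀ p, (ch p).card ≤ k + 1 := by
    intro p
    have hb := hB N (fun j => f j.1) (by simpa using h0)
      (fun i => by simpa using (hf i.1 i.2).1) p
    let c1 : Finset (Fin N) := Finset.univ.filter (fun i : Fin N =>
      (f i.1).tiles p ≠ none ∧ (f (i.1 + 1)).tiles p ≠ (f i.1).tiles p)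
    let c2 : Finset (Fin N) := Finset.univ.filter (fun i : Fin N =>
      (f i.1).tiles p = none ∧ (f (i.1 + 1)).tiles p ≠ none)
    have hc1 : c1.card ≤ k := by simpa [c1] using hb
    have hc2 : c2.card ≤ 1 := by
      rw [Finset.card_le_one]
      intro a ha b hb
      simp only [c2, Finset.mem_filter, Finset.mem_univ, true_and] at ha hb
      by_contra hab
      rcases lt_or_gt_of_ne hab with hlt | hlt
      · exact mono p (a.1 + 1) b.1 hlt b.2.le ha.2 hb.1
      · exact mono p (b.1 + 1) a.1 hlt a.2.le hb.2 ha.1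
    have hsub : ch p ⊆ c1 ∪ c2 := by
      intro i hi
      simp only [ch, c1, c2, Finset.mem_union, Finset.mem_filter, Finset.mem_univ,
        true_and] at hi ⊢
      by_cases e : (f i.1).tiles p = none
      · right; exact ⟨e, by rwa [e] at hi⟩
      · left; exact ⟨e, hi⟩
    have := (Finset.card_le_card hsub).trans (Finset.card_union_le _ _)
    omega
  have hcov : (Finset.univ : Finset (Fin N)) ⊆ F.biUnion ch := by
    intro i _
    have hne := (hf i.1 i.2).2
    have : ∃ p, (f (i.1 + 1)).tiles p ≠ (f i.1).tiles p := by
      by_contra hc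
      push Not at hc
      exact hne (asm_ext (funext fun p => (hc p).symm))
    obtain ⟨p, hp⟩ := this
    rw [Finset.mem_biUnion]
    refine ⟨p, hF p ?_, by simpa [ch] using hp⟩
    rw [← hN]
    refine mono p (i.1 + 1) N i.2 le_rfl ?_
    by_cases e : (f i.1).tiles p = none
    · rwa [e] at hp
    · exact step_supp (hf i.1 i.2).1 p e
  have h1 := Finset.card_le_card hcov
  rw [Finset.card_univ, Fintype.card_fin] at h1
  exact h1.trans (Finset.card_biUnion_le_card_mul _ _ _ (fun p _ => hcard p))

theorem seedX_occ {x y : ℤ} (h : seedX.tiles (x, y) ≠ none) : x = 0 ∧ y = 0 := by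
  by_contra hc
  apply h
  simp only [seedX, onePoint]
  rw [if_neg]
  simpa using hc

theorem region {m c : ℕ} {R : Block m → Option ℕ} {Y : TASystem} (hm : 0 < m)
    (hfz : AchievesFuzz m R Y c) {A : Assembly} (hA : Producible Y A) (hR : RepMap m R A seedX)
    (p : Pos) (hp : A.tiles p ≠ none) :
    p ∈ (Finset.Icc (-((m : ℤ) * c)) ((m : ℤ) * c + m)) ×ˢ
      (Finset.Icc (-((m : ℤ) * c)) ((m : ℤ) * c + m)) := by
  obtain ⟨a, b⟩ := p
  have hm' : (0 : ℤ) < m := by exact_mod_cast hm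
  have a1 := Int.mul_ediv_add_emod a m
  have a2 := Int.emod_nonneg a hm'.ne'
  have a3 := Int.emod_lt_of_pos a hm'
  have b1 := Int.mul_ediv_add_emod b m
  have b2 := Int.emod_nonneg b hm'.ne'
  have b3 := Int.emod_lt_of_pos b hm'
  set x := a / (m : ℤ)
  set y := b / (m : ℤ)
  have hne : blockAt m A x y ≠ emptyBlock m := by
    intro h
    have h' := congrFun h (⟨(a % m).toNat, by omega⟩, ⟨(b % m).toNat, by omega⟩)
    simp only [blockAt, emptyBlock, Int.toNat_of_nonneg a2, Int.toNat_of_nonneg b2, a1, b1] at h'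
    exact hp h'
  have hxy : |x| ≤ (c : ℤ) ∧ |y| ≤ (c : ℤ) := by
    by_cases hn : R (blockAt m A x y) = none
    · obtain ⟨u, v, hu, hv, h⟩ := hfz A hA x y hne hn
      rw [← hR] at h
      obtain ⟨e1, e2⟩ := seedX_occ h
      have : x = -u := by omega
      have : y = -v := by omega
      simp_all
    · rw [← hR] at hn
      obtain ⟨e1, e2⟩ := seedX_occ hn
      rw [e1, e2]; simp
  rw [abs_le, abs_le] at hxy
  obtain ⟨⟨x1, x2⟩, y1, y2⟩ := hxy
  simp only [Finset.mem_product, Finset.mem_Icc]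
  refine ⟨⟨?_, ?_⟩, ?_, ?_⟩ <;> nlinarith

theorem nbr_cases (p : Pos) (d : Bool) : nbr p d = (p.1 + 1, p.2) ∨ nbr p d = (p.1, p.2 - 1) := by
  cases d <;> simp [nbr]

/-- Pairwise meeting edges of the grid share a vertex. -/
theorem common_vertex {ι : Type} (i0 : ι) (p : ι → Pos) (d : ι → Bool)
    (h : ∀ i j, i ≠ j → p i = p j ∨ p i = nbr (p j) (d j) ∨ nbr (p i) (d i) = p j ∨
      nbr (p i) (d i) = nbr (p j) (d j)) :
    ∃ v, ∀ i, v = p i ∨ v = nbr (p i) (d i) := by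
  by_contra hc
  push Not at hc
  obtain ⟨i, hi1, hi2⟩ := hc (p i0)
  obtain ⟨j, hj1, hj2⟩ := hc (nbr (p i0) (d i0))
  have n1 : i0 ≠ i := by rintro rfl; exact hi1 rfl
  have n2 : i0 ≠ j := by rintro rfl; exact hj2 rfl
  have h1 := h i0 i n1
  have h2 := h i0 j n2
  have h3 : i ≠ j → _ := h i j
  have n3 : i ≠ j := by
    rintro rfl
    rcases h1 with h | h | h | h
    · exact hi1 h
    · exact hi2 h
    · exact hj1 h
    · exact hj2 h
  have h3 := h3 n3
  rcases nbr_cases (p i0) (d i0) with e0 | e0 <;> rcases nbr_cases (p i) (d i) with e1 | e1 <;>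
    rcases nbr_cases (p j) (d j) with e2 | e2 <;>
    simp only [e0, e1, e2, Ne, Prod.ext_iff] at * <;> omega

/-- The star of five positions. -/
def star5 (v : Pos) : Fin 5 → Pos :=
  ![v, (v.1 + 1, v.2), (v.1 - 1, v.2), (v.1, v.2 + 1), (v.1, v.2 - 1)]

theorem star5_mem (v p : Pos) (d : Bool) (hv : v = p ∨ v = nbr p d) (q : Pos)
    (hq : q = p ∨ q = nbr p d) : ∃ t, star5 v t = q := by
  obtain ⟨a, b⟩ := p
  cases d <;> simp only [nbr] at hv hq <;> rcases hv with rfl | rfl <;> rcases hq with rfl | rfl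
  · exact ⟨0, by simp [star5]⟩
  · exact ⟨4, by simp [star5]⟩
  · exact ⟨3, by simp [star5]⟩
  · exact ⟨0, by simp [star5]⟩
  · exact ⟨0, by simp [star5]⟩
  · exact ⟨1, by simp [star5]⟩
  · exact ⟨2, by simp [star5]⟩
  · exact ⟨0, by simp [star5]⟩

/-- Pairwise non-commuting steps all act inside one star. -/
theorem star_of_conflict {Γ : TASystem} {A : Assembly} (a : Pos) (ha : A.tiles a ≠ none)
    {ι : Type} (i0 : ι) (B : ι → Assembly) (hs : ∀ i, Step Γ A (B i))
    (hc : ∀ i j, i ≠ j → ¬ ∃ C, Step Γ (B i) C ∧ Step Γ (B j) C) :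
    ∃ v, (∀ i q, (∀ t, star5 v t ≠ q) → (B i).tiles q = A.tiles q) ∧
      ∀ i j q, (B i).tiles q = none → (B j).tiles q = none := by
  by_cases hat : ∃ i p σ, AttAt Γ A p σ ∧ B i = updAsm A p σ
  · obtain ⟨i, p, σ, h1, e1⟩ := hat
    have hall : ∀ j, ∃ τ, B j = updAsm A p τ := by
      intro j
      by_cases hij : i = j
      · exact ⟨σ, hij ▸ e1⟩
      rcases (step_iff _ _ _).1 (hs j) with ⟨q, τ, h2, e2⟩ | ⟨q, r, h2, e2⟩
      · by_cases hpq : p = q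
        · exact ⟨τ, hpq ▸ e2⟩
        · exact absurd (e1 ▸ e2 ▸ comm_att_att a ha h1 h2 hpq) (hc i j hij)
      · exact absurd (e1 ▸ e2 ▸ comm_att_tr h1 h2) (hc i j hij)
    refine ⟨p, ?_, ?_⟩
    · intro j q hq
      obtain ⟨τ, e⟩ := hall j
      have : q ≠ p := by rintro rfl; exact hq 0 (by simp [star5])
      rw [e, updAsm_ne _ _ _ _ this]
    · intro j k q hq
      obtain ⟨τ, e⟩ := hall j
      obtain ⟨τ', e'⟩ := hall k
      have : q ≠ p := by rintro rfl; rw [e, updAsm_self] at hq; cases hq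
      rw [e, updAsm_ne _ _ _ _ this] at hq
      rw [e', updAsm_ne _ _ _ _ this, hq]
  · have htr : ∀ i, ∃ p r, TrAt Γ A p r ∧ B i = trAsm A p r := by
      intro i
      rcases (step_iff _ _ _).1 (hs i) with ⟨q, τ, h2, e2⟩ | h
      · exact absurd ⟨i, q, τ, h2, e2⟩ hat
      · exact h
    choose p r ht e using htr
    obtain ⟨v, hv⟩ := common_vertex i0 p (fun i => (r i).2.2) (by
      intro i j hij
      by_contra hn
      push Not at hn
      apply hc i j hij
      rw [e i, e j]
      exact comm_tr_tr (ht i) (ht j) hn.1 hn.2.1 hn.2.2.1 hn.2.2.2)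
    refine ⟨v, ?_, ?_⟩
    · intro i q hq
      have hm := star5_mem v (p i) (r i).2.2 (hv i) q
      have h1 : ¬ (q = p i ∨ q = nbr (p i) (r i).2.2) := fun h => by
        obtain ⟨t, ht⟩ := hm h
        exact hq t ht
      push Not at h1
      rw [e i, trAsm_of_ne _ _ _ _ h1.1 h1.2]
    · intro i j q hq
      rw [e i, tr_supp (ht i)] at hq
      rw [e j, tr_supp (ht j)]
      exact hq

/-- A bounded seeded TA system with fewer than `n^(1/5)` states
(equivalently, with `|Σ_Y|^5 < n`) cannot non-committally simulate `X_n`. -/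
theorem noBoundedSim
    (n : ℕ) (Y : TASystem) (hB : Bounded Y) (hcard : Y.states.card ^ 5 < n)
    (m : ℕ) (R : Block m → Option ℕ) :
    ¬ Simulates m R Y (X n) := by
  rintro ⟨c, -, ⟨hm, hR0⟩, ⟨hE1, hE2⟩, hfz, hfol, hmod⟩
  obtain ⟨k, hk⟩ := hB
  have hseed : Producible (X n) seedX := Relation.ReflTransGen.refl
  obtain ⟨A0, hA0, hA0R⟩ := hE2 seedX hseed
  set F : Finset Pos := (Finset.Icc (-((m : ℤ) * c)) ((m : ℤ) * c + m)) ×ˢ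
      (Finset.Icc (-((m : ℤ) * c)) ((m : ℤ) * c + m)) with hFdef
  -- a maximal assembly representing the seed
  let P : ℕ → Prop := fun N => ∃ A, GenSeq Y N A ∧ RepMap m R A seedX
  have hbd : ∀ N, P N → N ≤ F.card * (k + 1) := by
    rintro N ⟨A, hA, hAR⟩
    exact genSeq_bound hk F hA (fun p hp => region hm hfz (genSeq_prod hA) hAR p hp)
  have hP0 : ∃ N, P N := by
    obtain ⟨N, hN⟩ := genSeq_exists hA0
    exact ⟨N, A0, hN, hA0R⟩
  obtain ⟨N0, hN0⟩ := hP0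
  have hmax := Nat.findGreatest_spec (P := P) (hbd N0 hN0) hN0
  set N := Nat.findGreatest P (F.card * (k + 1)) with hNdef
  obtain ⟨A, hAg, hAR⟩ := hmax
  have hterm : ∀ B, Step Y A B → A ≠ B → ¬ RepMap m R B seedX := by
    intro B hs hne hBR
    have hP : P (N + 1) := ⟨B, genSeq_succ hAg hs hne, hBR⟩
    have := Nat.le_findGreatest (hbd _ hP) hP
    omega
  have hA := genSeq_prod hAg
  -- the `n` steps
  have hsteps : ∀ i : Fin n, ∃ B, Step Y A B ∧ R (blockAt m B 1 0) = some (i.1 + 1) := by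
    intro i
    have hx := X_step n (i.1 + 1) (by omega) i.2
    obtain ⟨B', hB', hB'R⟩ := hmod seedX _ hseed (Relation.ReflTransGen.single hx) A hA hAR
    have hne : A ≠ B' := by
      rintro rfl
      have h1 := hAR 1 0
      have h2 := hB'R 1 0
      rw [← h1] at h2
      simp [seedDot, seedX, onePoint] at h2
    obtain ⟨C, hC1, hC2, hC3⟩ := first_change hB' hne
    have hCp : Producible Y C := Relation.ReflTransGen.tail hA hC1
    obtain ⟨D, hD, hDR⟩ := hE1 C hCp
    have r2 := hfol C B' hCp hC3 D _ hDR hB'R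
    have r1 := hfol A C hA (Relation.ReflTransGen.single hC1) seedX D hAR hDR
    refine ⟨C, hC1, ?_⟩
    rw [← hDR]
    rcases hd : D.tiles (1, 0) with _ | s
    · exfalso
      apply hterm C hC1 hC2
      have : seedX = D := by
        apply asm_ext
        funext q
        by_cases e0 : q = (0, 0)
        · have h0 : seedX.tiles q = some 0 := by simp [seedX, onePoint, e0]
          rw [h0, X_mono r1 q 0 h0]
        · have h0 : seedX.tiles q = none := by simp [seedX, onePoint, e0]
          rw [h0]
          by_cases e1 : q = (1, 0)
          · rw [e1, hd]
          · rcases hq : D.tiles q with _ | s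
            · rfl
            · have := X_mono r2 q s hq
              simp [seedDot, e0, e1] at this
      rw [this]; exact hDR
    · have := X_mono r2 _ s hd
      simp [seedDot] at this
      rw [this]
  choose B hBs hBR using hsteps
  have hBp : ∀ i, Producible Y (B i) := fun i => Relation.ReflTransGen.tail hA (hBs i)
  have hconf : ∀ i j, i ≠ j → ¬ ∃ C, Step Y (B i) C ∧ Step Y (B j) C := by
    rintro i j hij ⟨C, h1, h2⟩
    have key : ∀ i, Step Y (B i) C → R (blockAt m C 1 0) = some (i.1 + 1) := by
      intro i h
      obtain ⟨D, hD, hDR⟩ := hE1 _ (hBp i)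
      obtain ⟨E, hE, hER⟩ := hE1 C (Relation.ReflTransGen.tail (hBp i) h)
      have r := hfol _ C (hBp i) (Relation.ReflTransGen.single h) D E hDR hER
      rw [← hER]
      apply X_mono r
      rw [hDR]; exact hBR i
    have e := (key i h1).symm.trans (key j h2)
    simp only [Option.some.injEq, add_left_inj] at e
    exact hij (Fin.ext e)
  have hne : ∃ a, A.tiles a ≠ none := by
    by_contra hc
    push Not at hc
    have h0 := hAR 0 0
    have : blockAt m A 0 0 = emptyBlock m := by
      funext ij; simp only [blockAt, emptyBlock]; exact hc _
    rw [this, hR0] at h0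
    simp [seedX, onePoint] at h0
  obtain ⟨a, ha⟩ := hne
  have hn : 0 < n := by omega
  obtain ⟨v, hv1, hv2⟩ := star_of_conflict a ha ⟨0, hn⟩ B hBs hconf
  obtain ⟨s0, hs0⟩ := Option.ne_none_iff_exists'.1 ha
  have hs0' := prod_states hA a s0 hs0
  have hmem : ∀ i q, ((B i).tiles q).getD s0 ∈ Y.states := by
    intro i q
    rcases h : (B i).tiles q with _ | s
    · exact hs0'
    · exact prod_states (hBp i) q s h
  let g : Fin n → (Fin 5 → Y.states) := fun i t => ⟨_, hmem i (star5 v t)⟩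
  have hg : Function.Injective g := by
    intro i j hij
    have hB : B i = B j := by
      apply asm_ext
      funext q
      by_cases hq : ∃ t, star5 v t = q
      · obtain ⟨t, rfl⟩ := hq
        have h := congrArg Subtype.val (congrFun hij t)
        simp only [g] at h
        rcases h1 : (B i).tiles (star5 v t) with _ | s
        · rw [hv2 i j _ h1]
        · rcases h2 : (B j).tiles (star5 v t) with _ | s'
          · rw [hv2 j i _ h2] at h1; cases h1
          · rw [h1, h2] at h
            simp only [Option.getD_some] at h
            rw [h]
      · push Not at hq
        rw [hv1 i q hq, hv1 j q hq]
    have e := (hBR i).symm.trans ((congrArg (fun Z => R (blockAt m Z 1 0)) hB).trans (hBR j))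
    simp only [Option.some.injEq, add_left_inj] at e
    exact Fin.ext e
  have hle := Fintype.card_le_of_injective g hg
  simp at hle
  omega
end

section
/- The Freezing Seeded Tile Automata model is not intrinsically universal under non-committal simulation: for every freezing rule set I = (Σ, Π, Δ, τ), there exists a seeded Tile Automata system (indeed a passive one, namely X_n for n > |Σ|^5) that no freezing system using rule set I non-committally simulates. In particular, any freezing seeded TA system with |Σ| states is bounded (|Σ|-burnout), and a bounded system with fewer than n^{1/5} states cannot simulate X_n. -/
open scoped Classical

/-- `Γ` is freezing: along any production sequence from the seed, a tile can never
return to a previously held state (once a tile leaves a state it never re-enters it,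
i.e. if a tile is in state `σ` at two times, it is in state `σ` at all times between). -/
def Freezing (Γ : TASystem) : Prop :=
  ∀ (N : ℕ) (seq : Fin (N + 1) → Assembly), seq 0 = Γ.seed →
    (∀ i : Fin N, Step Γ (seq i.castSucc) (seq i.succ)) →
    ∀ (i j l : Fin (N + 1)) (p : Pos) (σ : ℕ),
      i ≤ l → l ≤ j →
      (seq i).tiles p = some σ → (seq j).tiles p = some σ →
      (seq l).tiles p = some σ

namespace TAaux

theorem asm_ext {A B : Assembly} (h : A.tiles = B.tiles) : A = B := by
  cases A; cases B; simp only at h; subst h; rfl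

/-- Add or overwrite a tile. -/
noncomputable def put (A : Assembly) (p : Pos) (σ : ℕ) : Assembly where
  tiles := Function.update A.tiles p (some σ)
  finite := Set.Finite.subset (A.finite.insert p) (by
    intro q hq
    by_cases h : q = p
    · exact Or.inl h
    · right
      simpa [Function.update_of_ne h] using hq)

def Dom (aff : ℕ → ℕ → Bool → ℕ) (A B : Assembly) : Prop :=
  ∀ p a, A.tiles p = some a → ∃ b, B.tiles p = some b ∧
    ∀ σ d, aff a σ d ≤ aff b σ d ∧ aff σ a d ≤ aff σ b d

theorem bond_mono {aff : ℕ → ℕ → Bool → ℕ} {A B : Assembly} (h : Dom aff A B) (p q : Pos) :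
    bond aff A p q ≤ bond aff B p q := by
  unfold bond
  cases hp : A.tiles p with
  | none => simp
  | some a =>
    cases hq : A.tiles q with
    | none => simp
    | some b =>
      obtain ⟨a', ha', h1⟩ := h p a hp
      obtain ⟨b', hb', h2⟩ := h q b hq
      rw [ha', hb']
      have key : ∀ d, aff a b d ≤ aff a' b' d := fun d =>
        le_trans (h1 b d).1 (h2 a' d).2
      simp only
      gcongr
      · split_ifs
        · exact key _
        · exact le_rfl
      · split_ifs
        · exact key _
        · exact le_rfl

theorem cut_mono {aff : ℕ → ℕ → Bool → ℕ} {A B : Assembly} (h : Dom aff A B) (S : Set Pos) :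
    cutWeight aff A S ≤ cutWeight aff B S := by
  unfold cutWeight
  have hsub : A.finite.toFinset ⊆ B.finite.toFinset := by
    intro p hp
    simp only [Set.Finite.mem_toFinset, Set.mem_setOf_eq] at hp ⊢
    obtain ⟨a, ha⟩ := Option.ne_none_iff_exists'.1 hp
    obtain ⟨b, hb, -⟩ := h p a ha
    simp [hb]
  refine le_trans (Finset.sum_le_sum_of_subset hsub) (Finset.sum_le_sum fun p _ => ?_)
  refine le_trans (Finset.sum_le_sum_of_subset hsub) (Finset.sum_le_sum fun q _ => ?_)
  split_ifs
  · exact Nat.add_le_add (bond_mono h p q) (bond_mono h q p)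
  · exact le_rfl

theorem dom_put {aff : ℕ → ℕ → Bool → ℕ} {A : Assembly} {p : Pos} {σ : ℕ}
    (h : A.tiles p = none) : Dom aff A (put A p σ) := by
  intro q a hq
  have : q ≠ p := by rintro rfl; simp [h] at hq
  exact ⟨a, by simp [put, Function.update_of_ne this, hq], fun _ _ => ⟨le_rfl, le_rfl⟩⟩

theorem stable_two {aff : ℕ → ℕ → Bool → ℕ} {τ : ℕ} {A B C D : Assembly}
    (hA : ∃ p, A.tiles p ≠ none)
    (hAB : Dom aff A B) (hAC : Dom aff A C)
    (hBD : Dom aff B D) (hCD : Dom aff C D)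
    (hD : ∀ p, D.tiles p ≠ none → B.tiles p ≠ none ∨ C.tiles p ≠ none)
    (hB : StableAt aff τ B) (hC : StableAt aff τ C) : StableAt aff τ D := by
  have up : ∀ {A B : Assembly}, Dom aff A B → ∀ p, A.tiles p ≠ none → B.tiles p ≠ none := by
    intro A B h p hp
    obtain ⟨a, ha⟩ := Option.ne_none_iff_exists'.1 hp
    obtain ⟨b, hb, -⟩ := h p a ha
    simp [hb]
  rintro S ⟨p, hp, hpS⟩ ⟨q, hq, hqS⟩
  obtain ⟨o, ho⟩ := hA
  have viaB : (∃ p, B.tiles p ≠ none ∧ p ∈ S) → (∃ p, B.tiles p ≠ none ∧ p ∉ S) →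
      τ ≤ cutWeight aff D S := fun h1 h2 => le_trans (hB S h1 h2) (cut_mono hBD S)
  have viaC : (∃ p, C.tiles p ≠ none ∧ p ∈ S) → (∃ p, C.tiles p ≠ none ∧ p ∉ S) →
      τ ≤ cutWeight aff D S := fun h1 h2 => le_trans (hC S h1 h2) (cut_mono hCD S)
  by_cases hoS : o ∈ S
  · rcases hD q hq with h | h
    · exact viaB ⟨o, up hAB o ho, hoS⟩ ⟨q, h, hqS⟩
    · exact viaC ⟨o, up hAC o ho, hoS⟩ ⟨q, h, hqS⟩
  · rcases hD p hp with h | h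
    · exact viaB ⟨p, h, hpS⟩ ⟨o, up hAB o ho, hoS⟩
    · exact viaC ⟨p, h, hpS⟩ ⟨o, up hAC o ho, hoS⟩

theorem nbr_ne (p : Pos) (d : Bool) : nbr p d ≠ p := by
  intro h
  have h1 := congrArg Prod.fst h
  have h2 := congrArg Prod.snd h
  cases d <;> simp [nbr] at h1 h2

theorem trans_dom {Γ : TASystem} {A B : Assembly} (h : TransStep Γ A B) : Dom Γ.aff A B := by
  obtain ⟨r, hr, p, h1, h2, h3⟩ := h
  obtain ⟨-, hs⟩ := Γ.rules_strengthening r hr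
  intro q a hq
  rw [h3]
  by_cases e2 : q = nbr p r.2.2
  · subst e2
    rw [h2] at hq; cases hq
    exact ⟨_, Function.update_self .., fun σ d => ⟨(hs σ d).2.2.1, (hs σ d).2.2.2⟩⟩
  · by_cases e1 : q = p
    · subst e1
      rw [h1] at hq; cases hq
      refine ⟨r.2.1.1, ?_, fun σ d => ⟨(hs σ d).1, (hs σ d).2.1⟩⟩
      rw [Function.update_of_ne e2, Function.update_self]
    · refine ⟨a, ?_, fun _ _ => ⟨le_rfl, le_rfl⟩⟩
      rw [Function.update_of_ne e2, Function.update_of_ne e1, hq]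

theorem trans_none {Γ : TASystem} {A B : Assembly} (h : TransStep Γ A B) (q : Pos)
    (hq : A.tiles q = none) : B.tiles q = none := by
  obtain ⟨r, hr, p, h1, h2, h3⟩ := h
  rw [h3]
  have e2 : q ≠ nbr p r.2.2 := by rintro rfl; simp [h2] at hq
  have e1 : q ≠ p := by rintro rfl; simp [h1] at hq
  rw [Function.update_of_ne e2, Function.update_of_ne e1, hq]

theorem step_ne_none {Γ : TASystem} {A B : Assembly} (h : Step Γ A B) (q : Pos)
    (hq : A.tiles q ≠ none) : B.tiles q ≠ none := by
  rcases h with ⟨p, σ, -, -, hB, -⟩ | h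
  · rw [hB]
    by_cases e : q = p
    · subst e; simp
    · rwa [Function.update_of_ne e]
  · obtain ⟨a, ha⟩ := Option.ne_none_iff_exists'.1 hq
    obtain ⟨b, hb, -⟩ := trans_dom h q a ha
    simp [hb]

theorem step_states {Γ : TASystem} {A B : Assembly} (h : Step Γ A B)
    (hA : ∀ p σ, A.tiles p = some σ → σ ∈ Γ.states) :
    ∀ p σ, B.tiles p = some σ → σ ∈ Γ.states := by
  intro q s hq
  rcases h with ⟨p, σ, hσ, -, hB, -⟩ | ⟨r, hr, p, h1, h2, h3⟩
  · rw [hB] at hq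
    by_cases e : q = p
    · subst e; simp at hq; subst hq; exact Γ.initial_sub hσ
    · rw [Function.update_of_ne e] at hq; exact hA _ _ hq
  · have hs := Γ.rules_states r hr
    rw [h3] at hq
    by_cases e2 : q = nbr p r.2.2
    · subst e2; simp at hq; subst hq; exact hs.2.2.2
    · rw [Function.update_of_ne e2] at hq
      by_cases e1 : q = p
      · subst e1; simp at hq; subst hq; exact hs.2.2.1
      · rw [Function.update_of_ne e1] at hq; exact hA _ _ hq

theorem freezing_burnout (Γ : TASystem) (hF : Freezing Γ) : Burnout Γ Γ.states.card := by
  intro N seq h0 hstep p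
  have hst : ∀ i : Fin (N + 1), ∀ p σ, (seq i).tiles p = some σ → σ ∈ Γ.states := by
    intro i
    induction i using Fin.induction with
    | zero => rw [h0]; exact Γ.seed_states
    | succ i ih => exact step_states (hstep i) ih
  refine Finset.card_le_card_of_injOn (fun i => ((seq i.castSucc).tiles p).getD 0) ?_ ?_
  · intro i hi
    simp only [Finset.coe_filter, Set.mem_setOf_eq, Finset.mem_univ, true_and] at hi
    obtain ⟨a, ha⟩ := Option.ne_none_iff_exists'.1 hi.1
    simp only [ha, Option.getD_some]
    exact hst _ _ _ ha
  · have key : ∀ i j : Fin N, i < j →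
        (seq i.castSucc).tiles p ≠ none → (seq i.succ).tiles p ≠ (seq i.castSucc).tiles p →
        (seq j.castSucc).tiles p ≠ none →
        ((seq i.castSucc).tiles p).getD 0 = ((seq j.castSucc).tiles p).getD 0 → False := by
      intro i j hij hi hi' hj he
      obtain ⟨a, ha⟩ := Option.ne_none_iff_exists'.1 hi
      obtain ⟨b, hb⟩ := Option.ne_none_iff_exists'.1 hj
      rw [ha, hb] at he
      simp only [Option.getD_some] at he
      subst he
      have := hF N seq h0 hstep i.castSucc j.castSucc i.succ p a
        (by rw [Fin.le_def]; simp) (by rw [Fin.le_def]; simp; omega) ha hb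
      exact hi' (by rw [this, ha])
    intro i hi j hj he
    simp only [Finset.coe_filter, Set.mem_setOf_eq, Finset.mem_univ, true_and] at hi hj
    rcases lt_trichotomy i j with h | h | h
    · exact (key i j h hi.1 hi.2 hj.1 he).elim
    · exact h
    · exact (key j i h hj.1 hj.2 hi.1 he.symm).elim

/-! The target system -/

theorem X_keep {n : ℕ} {A B : Assembly} (h : Reach (X n) A B) (p : Pos) (σ : ℕ)
    (hp : A.tiles p = some σ) : B.tiles p = some σ := by
  induction h with
  | refl => exact hp
  | tail _ hs ih =>
    rcases hs with ⟨q, s, -, hn, hB, -⟩ | ⟨r, hr, -⟩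
    · rw [hB]
      have : p ≠ q := by rintro rfl; simp [ih] at hn
      rw [Function.update_of_ne this, ih]
    · simp [X] at hr

theorem seedDot_reach {n i : ℕ} (h1 : 1 ≤ i) (h2 : i ≤ n) : Reach (X n) seedX (seedDot i) := by
  refine Relation.ReflTransGen.single (Or.inl ⟨(1, 0), i, ?_, ?_, ?_, ?_⟩)
  · simp [X, h1, h2]
  · simp [seedX, onePoint]
  · funext p
    by_cases e : p = ((1 : ℤ), (0 : ℤ))
    · subst e; simp [seedDot]
    · simp [seedDot, seedX, onePoint, Function.update_of_ne e, e]
  · have tl : ∀ p, (seedDot i).tiles p ≠ none → p = (0, 0) ∨ p = (1, 0) := by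
      intro p hp
      by_contra hc
      push Not at hc
      exact hp (by simp only [seedDot]; rw [if_neg hc.1, if_neg hc.2])
    have t0 : (seedDot i).tiles (0, 0) = some 0 := by simp [seedDot]
    have t1 : (seedDot i).tiles (1, 0) = some i := by simp [seedDot]
    have hb : bond (X n).aff (seedDot i) (0, 0) (1, 0) = 1 := by
      simp [bond, t0, t1, nbr, X, h1, h2]
    have m0 : ((0 : ℤ), (0 : ℤ)) ∈ (seedDot i).finite.toFinset := by simp [t0]
    have m1 : ((1 : ℤ), (0 : ℤ)) ∈ (seedDot i).finite.toFinset := by simp [t1]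
    have low : ∀ (S : Set Pos) (p q : Pos), p ∈ (seedDot i).finite.toFinset →
        q ∈ (seedDot i).finite.toFinset → p ∈ S → q ∉ S →
        bond (X n).aff (seedDot i) p q + bond (X n).aff (seedDot i) q p ≤
          cutWeight (X n).aff (seedDot i) S := by
      intro S p q hp hq hpS hqS
      unfold cutWeight
      refine le_trans ?_ (Finset.single_le_sum
        (f := fun p => ∑ q ∈ (seedDot i).finite.toFinset, if p ∈ S ∧ q ∉ S then
          bond (X n).aff (seedDot i) p q + bond (X n).aff (seedDot i) q p else 0)
        (fun _ _ => Nat.zero_le _) hp)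
      refine le_trans ?_ (Finset.single_le_sum
        (f := fun q => if p ∈ S ∧ q ∉ S then
          bond (X n).aff (seedDot i) p q + bond (X n).aff (seedDot i) q p else 0)
        (fun _ _ => Nat.zero_le _) hq)
      simp [hpS, hqS]
    rintro S ⟨p, hp, hpS⟩ ⟨q, hq, hqS⟩
    have ht : (X n).temp = 1 := rfl
    rw [ht]
    rcases tl p hp with rfl | rfl <;> rcases tl q hq with rfl | rfl
    · exact absurd hpS hqS
    · have := low S _ _ m0 m1 hpS hqS
      omega
    · have := low S _ _ m1 m0 hpS hqS
      omega
    · exact absurd hpS hqS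

theorem first_step {Γ : TASystem} {A B : Assembly} (h : Reach Γ A B) :
    A = B ∨ ∃ C, Step Γ A C ∧ C ≠ A ∧ Reach Γ C B := by
  induction h using Relation.ReflTransGen.head_induction_on with
  | refl => exact Or.inl rfl
  | @head A C hs hr ih =>
    by_cases e : C = A
    · subst e; exact ih
    · exact Or.inr ⟨C, hs, e, hr⟩

theorem reach_seq {Γ : TASystem} {A : Assembly} (h : Producible Γ A) :
    ∃ (L : ℕ) (g : ℕ → Assembly), g 0 = Γ.seed ∧ g L = A ∧
      ∀ i < L, Step Γ (g i) (g (i + 1)) := by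
  induction h with
  | refl => exact ⟨0, fun _ => Γ.seed, rfl, rfl, by simp⟩
  | @tail B C _ hs ih =>
    obtain ⟨L, g, h0, hL, hst⟩ := ih
    refine ⟨L + 1, fun i => if i ≤ L then g i else C, by simp [h0], by simp, ?_⟩
    intro i hi
    rcases Nat.lt_succ_iff_lt_or_eq.1 hi with h | h
    · have h' : i + 1 ≤ L := h
      simp only [h.le, h', if_true]
      exact hst i h
    · subst h
      simp [hL, hs]

/-- In a bounded system every site changes finitely often along an infinite run. -/
theorem finite_changes {Γ : TASystem} (hb : Bounded Γ) (f : ℕ → Assembly) (h0 : f 0 = Γ.seed)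
    (hs : ∀ i, Step Γ (f i) (f (i + 1))) (p : Pos) :
    {i | (f (i + 1)).tiles p ≠ (f i).tiles p}.Finite := by
  obtain ⟨k, hk⟩ := hb
  have hfin : {i | (f i).tiles p ≠ none ∧ (f (i + 1)).tiles p ≠ (f i).tiles p}.Finite := by
    by_contra hinf
    obtain ⟨t, ht, hc⟩ := Set.Infinite.exists_subset_card_eq hinf (k + 1)
    obtain ⟨N, hN⟩ : ∃ N, ∀ i ∈ t, i < N := ⟨t.sup id + 1, fun i hi =>
      Nat.lt_succ_of_le (Finset.le_sup (f := id) hi)⟩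
    have := hk N (fun i => f i) (by simpa using h0) (fun i => by simpa using hs i) p
    have h2 : t.card ≤ (Finset.univ.filter (fun i : Fin N =>
        (f (i.castSucc : Fin (N+1))).tiles p ≠ none ∧
        (f (i.succ : Fin (N+1))).tiles p ≠ (f (i.castSucc : Fin (N+1))).tiles p)).card := by
      refine Finset.card_le_card_of_surjOn (fun i : Fin N => (i : ℕ)) ?_
      intro i hi
      have := ht hi
      refine ⟨⟨i, hN i hi⟩, ?_, rfl⟩
      simpa using this
    omega
  have hsub : {i | (f i).tiles p = none ∧ (f (i + 1)).tiles p ≠ none}.Finite := by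
    apply Set.Subsingleton.finite
    have key : ∀ i j, i < j → (f (i + 1)).tiles p ≠ none → (f j).tiles p ≠ none := by
      intro i j hij h
      induction j, hij using Nat.le_induction with
      | base => exact h
      | succ j _ ih => exact step_ne_none (hs j) p ih
    intro i hi j hj
    rcases lt_trichotomy i j with h | h | h
    · exact absurd hj.1 (key i j h hi.2)
    · exact h
    · exact absurd hi.1 (key j i h hj.2)
  refine (hfin.union hsub).subset ?_
  intro i hi
  by_cases e : (f i).tiles p = none
  · right
    refine ⟨e, fun h => hi (by rw [h, e])⟩
  · exact Or.inl ⟨e, hi⟩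

theorem fuzz_pos {m c : ℕ} {R : Block m → Option ℕ} {Γ : TASystem} (hm : 0 < m)
    (hf : AchievesFuzz m R Γ c) {A : Assembly} (hA : Producible Γ A) (hr : RepMap m R A seedX)
    (p : Pos) (hp : A.tiles p ≠ none) :
    p ∈ (Set.Icc (-((m : ℤ) * (c + 1))) (m * (c + 1))) ×ˢ
      (Set.Icc (-((m : ℤ) * (c + 1))) (m * (c + 1))) := by
  obtain ⟨a, b⟩ := p
  have hm' : (0 : ℤ) < m := by exact_mod_cast hm
  have hsd : ∀ x y : ℤ, R (blockAt m A x y) ≠ none → x = 0 ∧ y = 0 := by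
    intro x y h
    rw [← hr x y] at h
    by_contra hc
    apply h
    simp only [seedX, onePoint]
    rw [if_neg]
    simpa using hc
  have ne : blockAt m A (a / m) (b / m) ≠ emptyBlock m := by
    intro h
    have hi1 := Int.emod_nonneg a hm'.ne'
    have hi2 := Int.emod_lt_of_pos a hm'
    have hj1 := Int.emod_nonneg b hm'.ne'
    have hj2 := Int.emod_lt_of_pos b hm'
    have := congrFun h (⟨(a % m).toNat, by omega⟩, ⟨(b % m).toNat, by omega⟩)
    simp only [blockAt, emptyBlock, Int.toNat_of_nonneg hi1, Int.toNat_of_nonneg hj1,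
      Int.mul_ediv_add_emod] at this
    exact hp this
  have hxy : |a / m| ≤ (c : ℤ) ∧ |b / m| ≤ (c : ℤ) := by
    by_cases e : R (blockAt m A (a / m) (b / m)) = none
    · obtain ⟨u, v, hu, hv, h⟩ := hf A hA _ _ ne e
      obtain ⟨h1, h2⟩ := hsd _ _ h
      rw [abs_le] at hu hv
      constructor <;> rw [abs_le] <;> constructor <;> omega
    · obtain ⟨h1, h2⟩ := hsd _ _ e
      rw [h1, h2]; simp
  have aux : ∀ a : ℤ, |a / m| ≤ (c : ℤ) → a ∈ Set.Icc (-((m : ℤ) * (c + 1))) (m * (c + 1)) := by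
    intro a h
    rw [abs_le] at h
    have h1 := Int.mul_ediv_add_emod a m
    have h2 := Int.emod_nonneg a hm'.ne'
    have h3 := Int.emod_lt_of_pos a hm'
    constructor <;> nlinarith
  exact ⟨aux a hxy.1, aux b hxy.2⟩

theorem exists_maximal {m c n : ℕ} {R : Block m → Option ℕ} {Γ : TASystem} (hb : Bounded Γ)
    (hsim : SimulatesFuzz m R Γ (X n) c) :
    ∃ A, Producible Γ A ∧ RepMap m R A seedX ∧
      ∀ B, Step Γ A B → RepMap m R B seedX → B = A := by
  obtain ⟨⟨hm, -⟩, hE, hf, -, -⟩ := hsim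
  by_contra hno
  push Not at hno
  obtain ⟨A0, hA0, hr0⟩ := hE.2 seedX Relation.ReflTransGen.refl
  choose! nx hn1 hn2 hn3 using hno
  obtain ⟨L, g, g0, gL, gs⟩ := reach_seq hA0
  set h : ℕ → Assembly := fun j => nx^[j] A0 with hh
  have hP : ∀ j, Producible Γ (h j) ∧ RepMap m R (h j) seedX := by
    intro j
    induction j with
    | zero => exact ⟨hA0, hr0⟩
    | succ j ih =>
      simp only [hh, Function.iterate_succ_apply']
      exact ⟨Relation.ReflTransGen.tail ih.1 (hn1 _ ih.1 ih.2), hn2 _ ih.1 ih.2⟩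
  have hS : ∀ j, Step Γ (h j) (h (j + 1)) ∧ h (j + 1) ≠ h j := by
    intro j
    have := hP j
    simp only [hh, Function.iterate_succ_apply'] at this ⊢
    exact ⟨hn1 _ this.1 this.2, hn3 _ this.1 this.2⟩
  set f : ℕ → Assembly := fun i => if i < L then g i else h (i - L) with hfdef
  have fh : ∀ j, f (L + j) = h j := by intro j; simp [hfdef]
  have f0 : f 0 = Γ.seed := by
    by_cases e : 0 < L
    · simp [hfdef, e, g0]
    · have : L = 0 := by omega
      subst this
      simp [hfdef, hh, ← gL, g0]
  have fs : ∀ i, Step Γ (f i) (f (i + 1)) := by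
    intro i
    by_cases e : i < L
    · have : f (i + 1) = g (i + 1) := by
        by_cases e2 : i + 1 < L
        · simp [hfdef, e2]
        · have : i + 1 = L := by omega
          rw [this, gL]
          exact fh 0
      rw [this]
      have : f i = g i := by simp [hfdef, e]
      rw [this]
      exact gs i e
    · obtain ⟨j, rfl⟩ := Nat.exists_eq_add_of_le (not_lt.1 e)
      rw [add_assoc, fh, fh]
      exact (hS j).1
  set F := (Set.Icc (-((m : ℤ) * (c + 1))) (m * (c + 1))) ×ˢ
      (Set.Icc (-((m : ℤ) * (c + 1))) (m * (c + 1))) with hF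
  have hFf : F.Finite := (Set.finite_Icc _ _).prod (Set.finite_Icc _ _)
  have hU : (⋃ p ∈ F, {i | (f (i + 1)).tiles p ≠ (f i).tiles p}).Finite :=
    hFf.biUnion fun p _ => finite_changes hb f f0 fs p
  refine (Set.Ici_infinite L) (hU.subset ?_)
  intro i hi
  obtain ⟨j, rfl⟩ := Nat.exists_eq_add_of_le (show L ≤ i from hi)
  have hne := (hS j).2
  obtain ⟨p, hp⟩ : ∃ p, (h (j + 1)).tiles p ≠ (h j).tiles p := by
    by_contra hc
    push Not at hc
    exact hne (asm_ext (funext hc))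
  have hp1 : (h (j + 1)).tiles p ≠ none := by
    intro hc
    apply hp
    rw [hc]
    by_contra hc2
    exact step_ne_none (hS j).1 p (Ne.symm hc2) hc
  simp only [Set.mem_iUnion]
  refine ⟨p, fuzz_pos hm hf (hP (j + 1)).1 (hP (j + 1)).2 p hp1, ?_⟩
  simp only [Set.mem_setOf_eq, add_assoc, fh]
  exact hp

/-! Commutation -/

theorem comm_attach {Γ : TASystem} {A B C : Assembly} (hA : ∃ p, A.tiles p ≠ none)
    {p q : Pos} {σ ρ : ℕ} (hpq : p ≠ q)
    (hσ : σ ∈ Γ.initial) (hp : A.tiles p = none)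
    (hB : B.tiles = Function.update A.tiles p (some σ)) (hBs : StableAt Γ.aff Γ.temp B)
    (hρ : ρ ∈ Γ.initial) (hq : A.tiles q = none)
    (hC : C.tiles = Function.update A.tiles q (some ρ)) (hCs : StableAt Γ.aff Γ.temp C) :
    ∃ D, Step Γ B D ∧ Step Γ C D := by
  have eB : B = put A p σ := asm_ext hB
  have eC : C = put A q ρ := asm_ext hC
  have hBq : B.tiles q = none := by rw [hB, Function.update_of_ne hpq.symm, hq]
  have hCp : C.tiles p = none := by rw [hC, Function.update_of_ne hpq, hp]
  have e : (put B q ρ).tiles = Function.update C.tiles p (some σ) := by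
    simp only [put]
    rw [hB, hC, Function.update_comm hpq]
  have eD : put B q ρ = put C p σ := asm_ext e
  have hD : StableAt Γ.aff Γ.temp (put B q ρ) := by
    refine stable_two hA (B := B) (C := C) ?_ ?_ (dom_put hBq) ?_ ?_ hBs hCs
    · rw [eB]; exact dom_put hp
    · rw [eC]; exact dom_put hq
    · rw [eD]; exact dom_put hCp
    · intro o ho
      by_cases h : o = q
      · right; rw [hC, h]; simp
      · left; simpa [put, Function.update_of_ne h] using ho
  exact ⟨put B q ρ, Or.inl ⟨q, ρ, hρ, hBq, rfl, hD⟩, Or.inl ⟨p, σ, hσ, hCp, e, hD⟩⟩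

theorem comm_attach_trans {Γ : TASystem} {A B C : Assembly}
    (hB : AttachStep Γ A B) (hC : TransStep Γ A C) :
    ∃ D, Step Γ B D ∧ Step Γ C D := by
  obtain ⟨p, σ, hσ, hp, hB, hBs⟩ := hB
  have hCp := trans_none hC p hp
  obtain ⟨r, hr, q, h1, h2, h3⟩ := hC
  have n1 : q ≠ p := by rintro rfl; simp [hp] at h1
  have n2 : nbr q r.2.2 ≠ p := by intro h; rw [h, hp] at h2; simp at h2
  have ht : TransStep Γ B (put C p σ) := by
    refine ⟨r, hr, q, ?_, ?_, ?_⟩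
    · rw [hB, Function.update_of_ne n1, h1]
    · rw [hB, Function.update_of_ne n2, h2]
    · simp only [put]
      rw [h3, hB, Function.update_comm n2, Function.update_comm n1]
  have hd := trans_dom ht
  refine ⟨put C p σ, Or.inr ht, Or.inl ⟨p, σ, hσ, hCp, rfl, ?_⟩⟩
  refine stable_two (A := B) (B := B) (C := B) ⟨p, by simp [hB]⟩ ?_ ?_ hd hd ?_ hBs hBs
  · exact fun q a h => ⟨a, h, fun _ _ => ⟨le_rfl, le_rfl⟩⟩
  · exact fun q a h => ⟨a, h, fun _ _ => ⟨le_rfl, le_rfl⟩⟩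
  · intro o ho
    left
    intro hc
    exact ho (trans_none ht o hc)

theorem comm_trans {Γ : TASystem} {A B C : Assembly} {r s : Rule} {p q : Pos}
    (hr : r ∈ Γ.rules) (hs : s ∈ Γ.rules)
    (h1 : A.tiles p = some r.1.1) (h2 : A.tiles (nbr p r.2.2) = some r.1.2)
    (h3 : B.tiles = Function.update (Function.update A.tiles p (some r.2.1.1))
      (nbr p r.2.2) (some r.2.1.2))
    (k1 : A.tiles q = some s.1.1) (k2 : A.tiles (nbr q s.2.2) = some s.1.2)
    (k3 : C.tiles = Function.update (Function.update A.tiles q (some s.2.1.1))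
      (nbr q s.2.2) (some s.2.1.2))
    (n1 : p ≠ q) (n2 : p ≠ nbr q s.2.2) (n3 : nbr p r.2.2 ≠ q)
    (n4 : nbr p r.2.2 ≠ nbr q s.2.2) :
    ∃ D, Step Γ B D ∧ Step Γ C D := by
  refine ⟨put (put B q s.2.1.1) (nbr q s.2.2) s.2.1.2,
    Or.inr ⟨s, hs, q, ?_, ?_, rfl⟩, Or.inr ⟨r, hr, p, ?_, ?_, ?_⟩⟩
  · rw [h3, Function.update_of_ne n3.symm, Function.update_of_ne n1.symm, k1]
  · rw [h3, Function.update_of_ne n4.symm, Function.update_of_ne n2.symm, k2]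
  · rw [k3, Function.update_of_ne n2, Function.update_of_ne n1, h1]
  · rw [k3, Function.update_of_ne n4, Function.update_of_ne n3, h2]
  · simp only [put]
    rw [h3, k3]
    funext o
    simp only [Function.update_apply]
    split_ifs <;> simp_all

/-- The eight oriented edges touching `p` or `nbr p d`. -/
def edgeAt (p q : Pos) (t : Bool × Bool × Bool) : Pos × Bool :=
  let o := if t.1 then p else q
  (if t.2.1 then o else if t.2.2 then (o.1 - 1, o.2) else (o.1, o.2 + 1), t.2.2)

theorem edge_self (o : Pos) (d : Bool) : ∀ x : Pos, nbr x d = o →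
    x = if d then (o.1 - 1, o.2) else (o.1, o.2 + 1) := by
  rintro ⟨a, b⟩ rfl
  cases d <;> simp [nbr]

theorem main (n : ℕ) (Y : TASystem) (hb : Bounded Y) (hn : Y.states.card ^ 5 < n)
    (m : ℕ) (R : Block m → Option ℕ) : ¬ Simulates m R Y (X n) := by
  rintro ⟨c, -, hsim⟩
  obtain ⟨A, hA, hrA, hmax⟩ := exists_maximal hb hsim
  obtain ⟨⟨hm, hRe⟩, hE, hf, hFol, hMod⟩ := hsim
  have hAne : ∃ p, A.tiles p ≠ none := by
    by_contra hc
    push Not at hc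
    have h1 := hrA 0 0
    have h2 : blockAt m A 0 0 = emptyBlock m := by
      funext ij; simp only [blockAt, emptyBlock]; exact hc _
    rw [h2, hRe] at h1
    simp [seedX, onePoint] at h1
  have keep : ∀ B D i, Producible Y B → Reach Y B D →
      R (blockAt m B 1 0) = some i → R (blockAt m D 1 0) = some i := by
    intro B D i hB hBD hi
    obtain ⟨B', -, hB'⟩ := hE.1 B hB
    obtain ⟨D', -, hD'⟩ := hE.1 D (Relation.ReflTransGen.trans hB hBD)
    have := X_keep (hFol B D hB hBD B' D' hB' hD') (1, 0) i (by rw [hB' 1 0, hi])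
    rw [← hD' 1 0, this]
  have step : ∀ i, 1 ≤ i → i ≤ n → ∃ B, Step Y A B ∧ B ≠ A ∧ R (blockAt m B 1 0) = some i := by
    intro i h1 h2
    obtain ⟨B', hB', hrB'⟩ := hMod seedX (seedDot i) Relation.ReflTransGen.refl
      (seedDot_reach h1 h2) A hA hrA
    rcases first_step hB' with rfl | ⟨B, hs, hne, hr⟩
    · have e1 := hrA 1 0
      have e2 := hrB' 1 0
      rw [← e1] at e2
      simp [seedDot, seedX, onePoint] at e2
    · refine ⟨B, hs, hne, ?_⟩
      have hPB : Producible Y B := Relation.ReflTransGen.tail hA hs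
      obtain ⟨C, -, hC⟩ := hE.1 B hPB
      have r1 := hFol A B hA (Relation.ReflTransGen.single hs) seedX C hrA hC
      have r2 := hFol B B' hPB hr C (seedDot i) hC hrB'
      have hCne : ¬ ∀ p, C.tiles p = seedX.tiles p := by
        intro h
        apply hne
        apply hmax B hs
        intro x y
        rw [← h, hC x y]
      push Not at hCne
      obtain ⟨p, hp⟩ := hCne
      have hX : seedX.tiles p = none := by
        by_contra hc
        obtain ⟨a, ha⟩ := Option.ne_none_iff_exists'.1 hc
        exact hp (by rw [ha, X_keep r1 p a ha])
      rw [hX] at hp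
      obtain ⟨a, ha⟩ := Option.ne_none_iff_exists'.1 hp
      have hd := X_keep r2 p a ha
      have hp0 : p ≠ ((0 : ℤ), (0 : ℤ)) := by rintro rfl; simp [seedX, onePoint] at hX
      simp only [seedDot, if_neg hp0] at hd
      split_ifs at hd with hp1
      · cases hd
        subst hp1
        rw [← hC 1 0, ha]
  haveI : Nonempty Assembly := ⟨A⟩
  choose! B hBs hBne hBR using step
  have noComm : ∀ i j, 1 ≤ i → i ≤ n → 1 ≤ j → j ≤ n →
      (∃ D, Step Y (B i) D ∧ Step Y (B j) D) → i = j := by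
    rintro i j i1 i2 j1 j2 ⟨D, hi, hj⟩
    have e1 := keep (B i) D i (Relation.ReflTransGen.tail hA (hBs i i1 i2))
      (Relation.ReflTransGen.single hi) (hBR i i1 i2)
    have e2 := keep (B j) D j (Relation.ReflTransGen.tail hA (hBs j j1 j2))
      (Relation.ReflTransGen.single hj) (hBR j j1 j2)
    rw [e1] at e2
    exact Option.some.inj e2
  have inj : ∀ i j, 1 ≤ i → i ≤ n → 1 ≤ j → j ≤ n → B i = B j → i = j := by
    intro i j i1 i2 j1 j2 h
    have := hBR i i1 i2
    rw [h, hBR j j1 j2] at this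
    exact (Option.some.inj this).symm
  have n1 : 1 ≤ n := by omega
  rcases hBs 1 le_rfl n1 with hat | htr
  · obtain ⟨p, σ, hσ, hp, hB, hBst⟩ := hat
    have hall : ∀ i, 1 ≤ i → i ≤ n → ∃ ρ ∈ Y.states,
        (B i).tiles = Function.update A.tiles p (some ρ) := by
      intro i i1 i2
      rcases eq_or_ne 1 i with rfl | hi
      · exact ⟨σ, Y.initial_sub hσ, hB⟩
      rcases hBs i i1 i2 with ⟨q, ρ, hρ, hq, hC, hCs⟩ | ht
      · by_cases hpq : p = q
        · subst hpq
          exact ⟨ρ, Y.initial_sub hρ, hC⟩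
        · exact absurd (noComm 1 i le_rfl n1 i1 i2
            (comm_attach hAne hpq hσ hp hB hBst hρ hq hC hCs)) hi
      · exact absurd (noComm 1 i le_rfl n1 i1 i2
          (comm_attach_trans ⟨p, σ, hσ, hp, hB, hBst⟩ ht)) hi
    choose! ρ hρ1 hρ2 using hall
    have : (Finset.Icc 1 n).card ≤ Y.states.card := by
      refine Finset.card_le_card_of_injOn ρ ?_ ?_
      · intro i hi
        have := Finset.mem_Icc.1 hi
        exact hρ1 i this.1 this.2
      · intro i hi j hj h
        have hi := Finset.mem_Icc.1 hi
        have hj := Finset.mem_Icc.1 hj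
        refine inj i j hi.1 hi.2 hj.1 hj.2 (asm_ext ?_)
        rw [hρ2 i hi.1 hi.2, hρ2 j hj.1 hj.2, h]
    rw [Nat.card_Icc] at this
    have h5 : Y.states.card ≤ Y.states.card ^ 5 := Nat.le_self_pow (by norm_num) _
    omega
  · have htr0 := htr
    obtain ⟨r, hr, p, h1, h2, h3⟩ := htr
    have hcard : 2 ≤ Y.states.card := by
      by_contra hc
      have hle : Y.states.card ≤ 1 := by omega
      rw [Finset.card_le_one] at hle
      obtain ⟨s1, s2, s3, s4⟩ := Y.rules_states r hr
      apply hBne 1 le_rfl n1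
      apply asm_ext
      rw [h3, ← hle _ s1 _ s3, ← hle _ s2 _ s4, ← h1, ← h2, Function.update_eq_self,
        Function.update_eq_self]
    have hall : ∀ i, 1 ≤ i → i ≤ n → ∃ t : Bool × Bool × Bool, ∃ x ∈ Y.states, ∃ y ∈ Y.states,
        (B i).tiles = Function.update (Function.update A.tiles (edgeAt p (nbr p r.2.2) t).1 (some x))
          (nbr (edgeAt p (nbr p r.2.2) t).1 (edgeAt p (nbr p r.2.2) t).2) (some y) := by
      intro i i1 i2
      rcases eq_or_ne 1 i with rfl | hi
      · obtain ⟨-, -, s3, s4⟩ := Y.rules_states r hr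
        refine ⟨(true, true, r.2.2), r.2.1.1, s3, r.2.1.2, s4, ?_⟩
        simpa [edgeAt] using h3
      rcases hBs i i1 i2 with ha | ⟨s, hs, q, k1, k2, k3⟩
      · exact absurd (noComm i 1 i1 i2 le_rfl n1 (comm_attach_trans ha htr0)) hi.symm
      · obtain ⟨-, -, s3, s4⟩ := Y.rules_states s hs
        have htouch : ∃ t, edgeAt p (nbr p r.2.2) t = (q, s.2.2) := by
          by_contra hno
          push Not at hno
          have m1 : p ≠ q := by
            rintro rfl
            exact hno (true, true, s.2.2) (by simp [edgeAt])
          have m2 : p ≠ nbr q s.2.2 := by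
            intro h
            refine hno (true, false, s.2.2) ?_
            have := edge_self p s.2.2 q h.symm
            simp [edgeAt, ← this]
          have m3 : nbr p r.2.2 ≠ q := by
            intro h
            exact hno (false, true, s.2.2) (by simp [edgeAt, h])
          have m4 : nbr p r.2.2 ≠ nbr q s.2.2 := by
            intro h
            refine hno (false, false, s.2.2) ?_
            have := edge_self (nbr p r.2.2) s.2.2 q h.symm
            simp [edgeAt, ← this]
          exact hi (noComm 1 i le_rfl n1 i1 i2
            (comm_trans hr hs h1 h2 h3 k1 k2 k3 m1 m2 m3 m4))
        obtain ⟨t, ht⟩ := htouch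
        refine ⟨t, s.2.1.1, s3, s.2.1.2, s4, ?_⟩
        rw [ht, k3]
    choose! t x hx y hy hxy using hall
    have : (Finset.Icc 1 n).card ≤
        ((Finset.univ : Finset (Bool × Bool × Bool)) ×ˢ (Y.states ×ˢ Y.states)).card := by
      refine Finset.card_le_card_of_injOn (fun i => (t i, x i, y i)) ?_ ?_
      · intro i hi
        have := Finset.mem_Icc.1 hi
        simp [hx i this.1 this.2, hy i this.1 this.2]
      · intro i hi j hj h
        have hi := Finset.mem_Icc.1 hi
        have hj := Finset.mem_Icc.1 hj
        simp only [Prod.mk.injEq] at h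
        refine inj i j hi.1 hi.2 hj.1 hj.2 (asm_ext ?_)
        rw [hxy i hi.1 hi.2, hxy j hj.1 hj.2, h.1, h.2.1, h.2.2]
    rw [Nat.card_Icc, Finset.card_product, Finset.card_product] at this
    simp at this
    have h8 : 8 * (Y.states.card * Y.states.card) ≤ Y.states.card ^ 5 := by
      have : 2 ^ 3 ≤ Y.states.card ^ 3 := Nat.pow_le_pow_left hcard 3
      calc 8 * (Y.states.card * Y.states.card) ≤ Y.states.card ^ 3 * (Y.states.card * Y.states.card) :=
            Nat.mul_le_mul_right _ this
        _ = _ := by ring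
    omega

end TAaux

/-- The Freezing Seeded Tile Automata model is not intrinsically
universal under non-committal simulation: for every rule set `I = (Σ, Π, Δ, τ)` there
is a passive system, namely `X_n` for `n > |Σ|^5`, that no freezing system using `I`
non-committally simulates. In particular, every freezing system with `|Σ|` states is
`|Σ|`-burnout, and a bounded system with fewer than `n^(1/5)` states (i.e. `|Σ|^5 < n`)
cannot simulate `X_n`. -/
theorem freezingNotIU :
    (∀ (St : Finset ℕ) (aff : ℕ → ℕ → Bool → ℕ) (Δ : Finset Rule) (τ : ℕ),
      ∃ n : ℕ, St.card ^ 5 < n ∧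
        ∀ ΓS : TASystem,
          ΓS.states = St → ΓS.aff = aff → ΓS.rules = Δ → ΓS.temp = τ →
          Freezing ΓS →
          ∀ (m : ℕ) (R : Block m → Option ℕ), ¬ Simulates m R ΓS (X n)) ∧
    (∀ Γ : TASystem, Freezing Γ → Burnout Γ Γ.states.card) ∧
    (∀ (n : ℕ) (Y : TASystem), Bounded Y → Y.states.card ^ 5 < n →
      ∀ (m : ℕ) (R : Block m → Option ℕ), ¬ Simulates m R Y (X n)) := by
  refine ⟨fun St aff Δ τ => ⟨St.card ^ 5 + 1, Nat.lt_succ_self _, ?_⟩,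
    TAaux.freezing_burnout, TAaux.main⟩
  intro ΓS h1 _ _ _ hF m R
  exact TAaux.main _ ΓS ⟨_, TAaux.freezing_burnout ΓS hF⟩ (by rw [h1]; omega) m R
end
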